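/- arXiv:math/0608245 — 2 statements merged into one kernel-verified Lean document; each statement's English description precedes it below -/
import Mathlib

section
/- Let r ≥ 3 and n ≥ 2r be integers, and let π = (d_1, d_2, ..., d_n) be an n-term graphic sequence with d_{r−2} ≥ r+1, d_{r+1} ≥ r, and d_r − 1 ≥ d_{d_{r+1}+2}. If d_i ≥ 2r−i for every i = 1, 2, ..., r−3, then π is potentially A_{r+1}-graphic. -/
open SimpleGraph Finset
open scoped Classical

/-- `G` contains a copy of `H` as a subgraph. -/
def ContainsCopy {α β : Type*} (G : SimpleGraph α) (H : SimpleGraph β) : Prop :=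
  ∃ f : β ↪ α, ∀ u v, H.Adj u v → G.Adj (f u) (f v)

/-- `G` is a realization of the degree sequence `d` (vertex `i` has degree `d i`). -/
def IsRealization {n : ℕ} (G : SimpleGraph (Fin n)) (d : Fin n → ℕ) : Prop :=
  ∀ i, G.degree i = d i

/-- `d` is a graphic sequence: it is nonincreasing and is the degree sequence of a
simple graph on `n` vertices. -/
def IsGraphic {n : ℕ} (d : Fin n → ℕ) : Prop :=
  Antitone d ∧ ∃ G : SimpleGraph (Fin n), IsRealization G d

/-- `d` is potentially `H`-graphic: some realization of `d` contains a copy of `H`. -/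
def PotentiallyGraphic {n : ℕ} (d : Fin n → ℕ) {β : Type*} (H : SimpleGraph β) : Prop :=
  ∃ G : SimpleGraph (Fin n), IsRealization G d ∧ ContainsCopy G H

/-- The set of even integers `l` such that every `n`-term graphic sequence with degree sum
at least `l` is potentially `H`-graphic; `σ(H, n)` is the least element of this set. -/
def SigmaSet {β : Type*} (H : SimpleGraph β) (n : ℕ) : Set ℕ :=
  {l | Even l ∧ ∀ d : Fin n → ℕ, IsGraphic d → l ≤ ∑ i, d i → PotentiallyGraphic d H}

/-- `K_m - H`: the complete graph on `m` vertices minus the edge set of a copy of `H`. -/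
def KsubH (m k : ℕ) (h : k ≤ m) (H : SimpleGraph (Fin k)) : SimpleGraph (Fin m) :=
  (⊤ : SimpleGraph (Fin m)) \ H.map (Fin.castLEEmb h)

/-- `Z₄ = K₄ - P₂`: the complete graph on 4 vertices minus two adjacent edges. -/
def Z4 : SimpleGraph (Fin 4) :=
  (⊤ : SimpleGraph (Fin 4)) \ SimpleGraph.fromEdgeSet {s(0, 1), s(1, 2)}

/-- The cycle on 4 vertices. -/
def C4 : SimpleGraph (Fin 4) :=
  SimpleGraph.fromEdgeSet {s(0, 1), s(1, 2), s(2, 3), s(3, 0)}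

/-- 1-indexed access `d_i` to a finite sequence (0 outside the range). -/
def nth {n : ℕ} (d : Fin n → ℕ) (i : ℕ) : ℕ :=
  if h : i - 1 < n then d ⟨i - 1, h⟩ else 0

/-- `d` is potentially `A_{r+1}`-graphic: it has a realization in which the `r + 1`
vertices of largest degree (the vertices of degrees `d₁, ..., d_{r+1}`) induce a
complete graph. -/
def PotentiallyA {n : ℕ} (d : Fin n → ℕ) (r : ℕ) : Prop :=
  ∃ G : SimpleGraph (Fin n), IsRealization G d ∧
    ∀ i j : Fin n, (i : ℕ) < r + 1 → (j : ℕ) < r + 1 → i ≠ j → G.Adj i j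

namespace SimpleGraph

section Attachment

variable {V : Type*}

/-- The number of members `N b`, `b ∈ A`, of a family of finsets that contain `z`. -/
noncomputable def coverCount (A : Finset V) (N : V → Finset V) (z : V) : ℤ :=
  ∑ b ∈ A, if z ∈ N b then 1 else 0

/-- The family `N` assigns to every `b ∈ A` a set of `e b` vertices outside `A`. -/
def IsAttachment (A : Finset V) (e : V → ℕ) (N : V → Finset V) : Prop :=
  ∀ b ∈ A, (N b).card = e b ∧ Disjoint (N b) A

/-- Replace `y` by `x` in the member `N a` of the family `N`. -/
noncomputable def shift (N : V → Finset V) (a y x : V) : V → Finset V :=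
  Function.update N a (insert x ((N a).erase y))

theorem IsAttachment.shift {A : Finset V} {e : V → ℕ} {N : V → Finset V}
    (hN : IsAttachment A e N) {a y x : V} (hy : y ∈ N a) (hx : x ∉ N a) (hxA : x ∉ A) :
    IsAttachment A e (shift N a y x) := by
  intro b hb
  by_cases hba : b = a
  · subst hba
    have h := hN b hb
    have hpos := Finset.card_pos.2 ⟨y, hy⟩
    rw [SimpleGraph.shift, Function.update_self, Finset.card_insert_of_notMem (by simp [hx]),
      Finset.card_erase_of_mem hy, Finset.disjoint_insert_left]
    exact ⟨by omega, hxA, h.2.mono_left (Finset.erase_subset _ _)⟩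
  · rw [SimpleGraph.shift, Function.update_of_ne hba]
    exact hN b hb

theorem coverCount_shift {A : Finset V} {N : V → Finset V} {a y x : V} (ha : a ∈ A)
    (hy : y ∈ N a) (hx : x ∉ N a) (z : V) :
    coverCount A (shift N a y x) z =
      coverCount A N z + (if z = x then 1 else 0) - (if z = y then 1 else 0) := by
  have hxy : x ≠ y := by rintro rfl; exact hx hy
  have h : ∑ b ∈ A.erase a, (if z ∈ shift N a y x b then (1 : ℤ) else 0) =
      ∑ b ∈ A.erase a, if z ∈ N b then (1 : ℤ) else 0 :=
    Finset.sum_congr rfl fun b hb => by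
      rw [shift, Function.update_of_ne (Finset.ne_of_mem_erase hb)]
  rw [coverCount, coverCount, ← Finset.add_sum_erase _ _ ha, ← Finset.add_sum_erase _ _ ha, h,
    shift, Function.update_self]
  simp only [Finset.mem_insert, Finset.mem_erase]
  grind

theorem exists_mem_of_coverCount_lt {A : Finset V} {N : V → Finset V} {x y : V}
    (h : coverCount A N x < coverCount A N y) : ∃ b ∈ A, y ∈ N b ∧ x ∉ N b := by
  obtain ⟨b, hb, hlt⟩ := Finset.exists_lt_of_sum_lt h
  refine ⟨b, hb, ?_⟩
  grind

theorem sum_coverCount (A T : Finset V) (N : V → Finset V) :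
    ∑ z ∈ T, coverCount A N z = ∑ b ∈ A, ((T ∩ N b).card : ℤ) := by
  simp only [coverCount]
  rw [Finset.sum_comm]
  refine Finset.sum_congr rfl fun b _ => ?_
  rw [Finset.sum_boole, Finset.filter_mem_eq_inter]

/-- An attachment minimising the sum of squares of `f - coverCount` is balanced. -/
theorem exists_balanced_attachment [Fintype V] (f : V → ℤ) (A P : Finset V) (e : V → ℕ)
    (hP : Disjoint P A) (he : ∀ b ∈ A, e b ≤ P.card) :
    ∃ N, IsAttachment A e N ∧ ∀ N', IsAttachment A e N' → ∀ x y, x ∉ A → y ∉ A → x ≠ y →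
      (∀ z, coverCount A N' z =
        coverCount A N z + (if z = x then 1 else 0) - (if z = y then 1 else 0)) →
      f x - coverCount A N x ≤ f y - coverCount A N y + 1 := by
  have hex : ∀ b, ∃ T : Finset V, b ∈ A → T ⊆ P ∧ T.card = e b := by
    intro b
    by_cases hb : b ∈ A
    · obtain ⟨T, hT⟩ := Finset.exists_subset_card_eq (he b hb)
      exact ⟨T, fun _ => hT⟩
    · exact ⟨∅, fun h => absurd h hb⟩
  choose N₀ hN₀ using hex
  obtain ⟨N, hN, hmin⟩ := Finset.exists_min_image
    (Finset.univ.filter fun N : V → Finset V => IsAttachment A e N)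
    (fun N => ∑ z ∈ Aᶜ, (f z - coverCount A N z) ^ 2) ⟨N₀, by
      rw [Finset.mem_filter]
      exact ⟨Finset.mem_univ _, fun b hb =>
        ⟨(hN₀ b hb).2, hP.mono_left (hN₀ b hb).1⟩⟩⟩
  simp only [Finset.mem_filter, Finset.mem_univ, true_and] at hN hmin
  refine ⟨N, hN, fun N' hN' x y hx hy hxy hmul => ?_⟩
  have h1 := hmin N' hN'
  have h2 : ∑ z ∈ Aᶜ, (f z - coverCount A N' z) ^ 2 =
      ∑ z ∈ Aᶜ, ((f z - coverCount A N z) ^ 2 +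
        ((if z = x then 1 - 2 * (f x - coverCount A N x) else 0) +
          (if z = y then 1 + 2 * (f y - coverCount A N y) else 0))) := by
    refine Finset.sum_congr rfl fun z _ => ?_
    rw [hmul]
    by_cases hzx : z = x
    · subst hzx
      simp only [hxy, if_true, if_false]
      ring
    · by_cases hzy : z = y
      · subst hzy
        simp only [hzx, if_true, if_false]
        ring
      · simp [hzx, hzy]
  rw [h2, Finset.sum_add_distrib, Finset.sum_add_distrib, Finset.sum_ite_eq', Finset.sum_ite_eq',
    if_pos (by simpa using hx), if_pos (by simpa using hy)] at h1
  linarith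

end Attachment

variable {V : Type*} [Fintype V]

/-- The neighbourhood of a vertex, as a finset chosen by classical decidability. -/
noncomputable def nbhd (G : SimpleGraph V) (x : V) : Finset V :=
  Finset.univ.filter fun y => G.Adj x y

/-- The degree of a vertex, free of decidability instances. -/
noncomputable def deg (G : SimpleGraph V) (x : V) : ℕ := (G.nbhd x).card

@[simp]
theorem mem_nbhd {G : SimpleGraph V} {x y : V} : y ∈ G.nbhd x ↔ G.Adj x y := by simp [nbhd]

theorem card_nbhd (G : SimpleGraph V) (x : V) : (G.nbhd x).card = G.deg x := rfl

theorem deg_eq_degree (G : SimpleGraph V) (x : V) : G.deg x = G.degree x := by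
  rw [← card_neighborFinset_eq_degree, neighborFinset_eq_filter]
  rfl

theorem deg_pos_iff {G : SimpleGraph V} {x : V} : 0 < G.deg x ↔ ∃ y, G.Adj x y := by
  rw [← card_nbhd, Finset.card_pos]
  exact exists_congr fun y => mem_nbhd

theorem deg_lt_card (G : SimpleGraph V) (x : V) : G.deg x < Fintype.card V := by
  rw [deg_eq_degree]
  exact G.degree_lt_card_verts x

theorem sum_deg (G : SimpleGraph V) : ∑ x, G.deg x = 2 * G.edgeFinset.card := by
  simp only [deg_eq_degree, sum_degrees_eq_twice_card_edges]

theorem deg_sup_of_disjoint {G H : SimpleGraph V} (h : Disjoint G H) (x : V) :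
    (G ⊔ H).deg x = G.deg x + H.deg x := by
  simp only [← card_nbhd, nbhd]
  rw [← Finset.card_union_of_disjoint]
  · congr 1
    ext y
    simp
  · rw [Finset.disjoint_left]
    intro y hy hy'
    simp only [Finset.mem_filter, Finset.mem_univ, true_and] at hy hy'
    have := h.le_bot (show (G ⊓ H).Adj x y from ⟨hy, hy'⟩)
    simp at this

theorem deg_edge {a b : V} (hab : a ≠ b) (x : V) :
    (edge a b).deg x = (if x = a then 1 else 0) + (if x = b then 1 else 0) := by
  rw [← card_nbhd]
  by_cases h1 : x = a
  · rw [if_pos h1, if_neg (h1.trans_ne hab), Finset.card_eq_one]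
    exact ⟨b, by ext y; rw [mem_nbhd, edge_adj]; grind⟩
  · by_cases h2 : x = b
    · rw [if_neg h1, if_pos h2, Finset.card_eq_one]
      exact ⟨a, by ext y; rw [mem_nbhd, edge_adj]; grind⟩
    · rw [if_neg h1, if_neg h2, Finset.card_eq_zero, Finset.eq_empty_iff_forall_notMem]
      intro y
      rw [mem_nbhd, edge_adj]
      grind

theorem deg_sup_edge {G : SimpleGraph V} {a b : V} (hab : a ≠ b) (h : ¬G.Adj a b) (x : V) :
    (G ⊔ edge a b).deg x =
      G.deg x + (if x = a then 1 else 0) + (if x = b then 1 else 0) := by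
  rw [deg_sup_of_disjoint, deg_edge hab, add_assoc]
  rw [disjoint_left]
  intro u v huv huv'
  rw [edge_adj] at huv'
  grind [G.adj_comm u v]

theorem deg_sdiff_edge {G : SimpleGraph V} {a b : V} (h : G.Adj a b) (x : V) :
    (G \ edge a b).deg x + (if x = a then 1 else 0) + (if x = b then 1 else 0) =
      G.deg x := by
  rw [← deg_sup_edge h.ne (by simp [edge_adj, h.ne])]
  congr!
  ext u v
  simp only [sup_adj, sdiff_adj, edge_adj]
  grind [G.adj_comm u v]

/-- Degree-preserving switch of the edges `ab`, `cd` to `ac`, `bd`. -/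
theorem exists_switch {G : SimpleGraph V} {a b c d : V} (hab : G.Adj a b) (hcd : G.Adj c d)
    (hac : ¬G.Adj a c) (hbd : ¬G.Adj b d) (hac' : a ≠ c) (hbd' : b ≠ d) :
    ∃ G' : SimpleGraph V, (∀ x, G'.deg x = G.deg x) ∧
      ∀ x y, G'.Adj x y ↔ (G.Adj x y ∧ s(x, y) ≠ s(a, b) ∧ s(x, y) ≠ s(c, d)) ∨
        s(x, y) = s(a, c) ∨ s(x, y) = s(b, d) := by
  have hne := hab.ne
  have hne' := hcd.ne
  have had : a ≠ d := by rintro rfl; exact hac hcd.symm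
  have hbc : b ≠ c := by rintro rfl; exact hac hab
  refine ⟨((G \ edge a b) \ edge c d) ⊔ edge a c ⊔ edge b d, fun x => ?_, fun x y => ?_⟩
  · rw [deg_sup_edge hbd', deg_sup_edge hac']
    · have h1 := deg_sdiff_edge hab x
      have h2 := deg_sdiff_edge (G := G \ edge a b) (a := c) (b := d)
        (by simp only [sdiff_adj, edge_adj]; grind) x
      grind
    · simp [hac]
    · simp only [sup_adj, sdiff_adj, edge_adj]; grind
  · simp only [sup_adj, sdiff_adj, edge_adj, ne_eq, Sym2.eq_iff]
    have := G.ne_of_adj (a := x) (b := y)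
    grind

theorem exists_adj_not_adj {G : SimpleGraph V} {v u w : V} (hw : G.Adj v w) (hu : ¬G.Adj v u)
    (hvu : v ≠ u) (hd : G.deg w ≤ G.deg u) : ∃ z, G.Adj u z ∧ ¬G.Adj w z ∧ z ≠ w := by
  by_contra! hcon
  have hwu : w ≠ u := by rintro rfl; exact hu hw
  have hlt : ((G.nbhd u).erase w).card < ((G.nbhd w).erase u).card := by
    apply Finset.card_lt_card
    refine ⟨fun z hz => ?_, fun hsub => ?_⟩
    · simp only [Finset.mem_erase, mem_nbhd] at hz ⊢
      have := hcon z hz.2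
      have := hz.2.ne
      grind
    · have := hsub (x := v) (by simp [hw.symm, hvu])
      simp only [Finset.mem_erase, mem_nbhd] at this
      exact hu this.2.symm
  rw [Finset.card_erase_eq_ite, Finset.card_erase_eq_ite, card_nbhd,
    card_nbhd] at hlt
  simp only [mem_nbhd, G.adj_comm w u] at hlt
  split_ifs at hlt <;> omega

theorem exists_realization_adj_iff_mem (f : V → ℕ) (v : V) (S : Finset V) (hvS : v ∉ S)
    (hS : S.card = f v) (htop : ∀ u ∈ S, ∀ w, w ∉ S → w ≠ v → f w ≤ f u)
    (hf : ∃ G : SimpleGraph V, ∀ x, G.deg x = f x) :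
    ∃ G : SimpleGraph V, (∀ x, G.deg x = f x) ∧ ∀ x, G.Adj v x ↔ x ∈ S := by
  obtain ⟨G₀, hG₀⟩ := hf
  obtain ⟨G, hG, hmax⟩ := Finset.exists_max_image
    (Finset.univ.filter fun G : SimpleGraph V => ∀ x, G.deg x = f x)
    (fun G => (G.nbhd v ∩ S).card) ⟨G₀, by simpa using hG₀⟩
  simp only [Finset.mem_filter, Finset.mem_univ, true_and] at hG hmax
  refine ⟨G, hG, ?_⟩
  have hcard : (G.nbhd v).card = S.card := by
    rw [card_nbhd, hG, hS]
  suffices h : G.nbhd v = S by intro x; rw [← h, mem_nbhd]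
  by_contra hne
  obtain ⟨u, huS, hu⟩ : ∃ u ∈ S, u ∉ G.nbhd v := by
    by_contra! h
    exact hne (Finset.eq_of_subset_of_card_le h hcard.le).symm
  obtain ⟨w, hw, hwS⟩ : ∃ w ∈ G.nbhd v, w ∉ S := by
    by_contra! h
    exact hne (Finset.eq_of_subset_of_card_le h hcard.ge)
  rw [mem_nbhd] at hu hw
  have hvu : v ≠ u := by rintro rfl; exact hvS huS
  obtain ⟨z, hz, hwz, hzw⟩ := exists_adj_not_adj hw hu hvu
    (by rw [hG, hG]; exact htop u huS w hwS hw.ne')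
  obtain ⟨G', hdeg, hadj⟩ := exists_switch hw hz hu hwz hvu hzw.symm
  have hlt : (G.nbhd v ∩ S).card < (G'.nbhd v ∩ S).card := by
    apply Finset.card_lt_card
    refine ⟨fun x hx => ?_, fun hsub => ?_⟩
    · simp only [Finset.mem_inter, mem_nbhd, hadj] at hx ⊢
      refine ⟨Or.inl ⟨hx.1, ?_, ?_⟩, hx.2⟩
      · simp only [ne_eq, Sym2.eq_iff]; grind
      · simp only [ne_eq, Sym2.eq_iff]; grind
    · have := hsub (x := u) (by simp [hadj, huS])
      simp [hu] at this
  exact absurd (hmax G' fun x => by rw [hdeg, hG]) (by omega)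

/-- Residual of `f` after a vertex `v` is joined to `S` and removed (left isolated). -/
noncomputable def residualDegree (f : V → ℕ) (v : V) (S : Finset V) (x : V) : ℕ :=
  if x = v then 0 else if x ∈ S then f x - 1 else f x

theorem residual_realizable (f : V → ℕ) (v : V) (S : Finset V) (hvS : v ∉ S)
    (hS : S.card = f v) (htop : ∀ u ∈ S, ∀ w, w ∉ S → w ≠ v → f w ≤ f u)
    (hf : ∃ G : SimpleGraph V, ∀ x, G.deg x = f x) :
    (∃ G : SimpleGraph V, ∀ x, G.deg x = residualDegree f v S x) ∧
      ∀ H : SimpleGraph V, (∀ x, H.deg x = residualDegree f v S x) →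
        ∃ G : SimpleGraph V, (∀ x, G.deg x = f x) ∧ H ≤ G ∧ ∀ x ∈ S, G.Adj v x := by
  obtain ⟨G, hG, hN⟩ := exists_realization_adj_iff_mem f v S hvS hS htop hf
  let star : SimpleGraph V := SimpleGraph.fromRel fun x y => x = v ∧ y ∈ S
  have hstar : ∀ x y, star.Adj x y ↔ (x = v ∧ y ∈ S) ∨ (y = v ∧ x ∈ S) := by
    intro x y
    simp only [star, fromRel_adj]
    grind
  have hle : star ≤ G := by
    intro x y h
    rcases (hstar x y).1 h with ⟨rfl, hy⟩ | ⟨rfl, hx⟩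
    · exact (hN _).2 hy
    · exact ((hN _).2 hx).symm
  have hdeg : ∀ x, star.deg x + residualDegree f v S x = f x := by
    intro x
    rw [residualDegree, ← card_nbhd, nbhd]
    simp only [hstar]
    by_cases hx : x = v
    · subst hx
      simp [hvS, hS]
    · by_cases hxS : x ∈ S
      · have : 0 < f x := by
          rw [← hG, deg_pos_iff]
          exact ⟨v, ((hN x).2 hxS).symm⟩
        simp only [hx, hxS, false_and, and_true, false_or, if_false, if_true]
        rw [Finset.card_eq_one.2 ⟨v, by ext; simp⟩]
        omega
      · simp [hx, hxS]
  refine ⟨⟨G \ star, fun x => ?_⟩, fun H hH => ⟨star ⊔ H, fun x => ?_, le_sup_right, ?_⟩⟩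
  · have h := deg_sup_of_disjoint (G := star) (H := G \ star) disjoint_sdiff_self_right x
    have h2 : (star ⊔ G \ star).deg x = G.deg x := by
      congr!
      exact sup_sdiff_cancel_right hle
    have := hdeg x
    have := hG x
    omega
  · rw [deg_sup_of_disjoint, hH, hdeg]
    rw [disjoint_left]
    have hv : ∀ y, ¬H.Adj v y := by
      intro y hy
      have : 0 < H.deg v := by
        rw [deg_pos_iff]
        exact ⟨y, hy⟩
      rw [hH] at this
      simp [residualDegree] at this
    intro x y h h'
    rcases (hstar x y).1 h with ⟨rfl, _⟩ | ⟨rfl, _⟩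
    · exact hv _ h'
    · exact hv _ h'.symm
  · intro x hx
    exact Or.inl ((hstar _ _).2 (Or.inl ⟨rfl, hx⟩))

theorem exists_top_set (f : V → ℕ) (v : V) (S₀ : Finset V) (k : ℕ) (hv : v ∉ S₀)
    (hk : S₀.card ≤ k) (hk' : k < Fintype.card V)
    (h₀ : ∀ u ∈ S₀, ∀ w, w ∉ S₀ → w ≠ v → f w ≤ f u) :
    ∃ S : Finset V, S₀ ⊆ S ∧ v ∉ S ∧ S.card = k ∧
      ∀ u ∈ S, ∀ w, w ∉ S → w ≠ v → f w ≤ f u := by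
  obtain ⟨S₁, hS₁, hS₁', hc⟩ := Finset.exists_subsuperset_card_eq
    (s := S₀) (t := Finset.univ.erase v) (n := k) (by
      intro x hx
      simp only [Finset.mem_erase, Finset.mem_univ, and_true]
      rintro rfl
      exact hv hx) hk (by
      rw [Finset.card_erase_of_mem (Finset.mem_univ _), Finset.card_univ]
      omega)
  obtain ⟨S, hS, hmax⟩ := Finset.exists_max_image
    (Finset.univ.filter fun S : Finset V => S₀ ⊆ S ∧ v ∉ S ∧ S.card = k)
    (fun S => ∑ x ∈ S, f x) ⟨S₁, by
      simp only [Finset.mem_filter, Finset.mem_univ, true_and]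
      exact ⟨hS₁, fun h => by simpa using hS₁' h, hc⟩⟩
  simp only [Finset.mem_filter, Finset.mem_univ, true_and] at hS hmax
  refine ⟨S, hS.1, hS.2.1, hS.2.2, fun u hu w hw hwv => ?_⟩
  by_cases hu₀ : u ∈ S₀
  · exact h₀ u hu₀ w (fun h => hw (hS.1 h)) hwv
  have hw' : w ∉ S.erase u := fun h => hw (Finset.mem_of_mem_erase h)
  have := hmax (insert w (S.erase u)) ⟨fun x hx => ?_, ?_, ?_⟩
  · rw [Finset.sum_insert hw'] at this
    have := Finset.add_sum_erase S f hu
    omega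
  · have := hS.1 hx
    grind
  · grind
  · rw [Finset.card_insert_of_notMem hw', Finset.card_erase_of_mem hu]
    have := Finset.card_pos.2 ⟨u, hu⟩
    omega

/-- A function of even sum bounded by `h` is a degree function as soon as at least `h + 1` of its
values are within one of `h`. -/
theorem exists_deg_eq_of_near_regular (g : V → ℕ) (h : ℕ) (L : Finset V)
    (hg : ∀ x, g x ≤ h) (hL : ∀ x ∈ L, h ≤ g x + 1) (hcard : h + 1 ≤ L.card)
    (heven : Even (∑ x, g x)) : ∃ H : SimpleGraph V, ∀ x, H.deg x = g x := by
  obtain ⟨H, hH, hmax⟩ := Finset.exists_max_image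
    (Finset.univ.filter fun H : SimpleGraph V => ∀ x, H.deg x ≤ g x)
    (fun H => ∑ x, H.deg x) ⟨⊥, by
      rw [Finset.mem_filter]
      exact ⟨Finset.mem_univ _, fun x => by simp [deg, nbhd]⟩⟩
  simp only [Finset.mem_filter, Finset.mem_univ, true_and] at hH hmax
  have hmax' : ∀ (H' : SimpleGraph V) (u v : V), H.deg u < g u → H.deg v < g v →
      (u = v → H.deg u + 2 ≤ g u) →
      ¬∀ x, H'.deg x = H.deg x + (if x = u then 1 else 0) + (if x = v then 1 else 0) := by
    intro H' u v hu hv huv hH'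
    have h1 := hmax H' (fun x => by rw [hH']; have := hH x; grind)
    have h2 : ∑ x, H.deg x < ∑ x, H'.deg x := by
      apply Finset.sum_lt_sum
      · intro x _
        rw [hH']
        omega
      · exact ⟨u, Finset.mem_univ _, by rw [hH']; simp; omega⟩
    omega
  refine ⟨H, ?_⟩
  by_contra! hex
  obtain ⟨u, hu⟩ := hex
  replace hu : H.deg u < g u := lt_of_le_of_ne (hH u) hu
  obtain ⟨v, hv, huv⟩ : ∃ v, H.deg v < g v ∧ (u = v → H.deg u + 2 ≤ g u) := by
    by_contra! hcon
    have h1 : ∀ x, x ≠ u → H.deg x = g x := by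
      intro x hx
      by_contra hx'
      exact hx (hcon x (lt_of_le_of_ne (hH x) hx')).1.symm
    have h2 := (hcon u hu).2
    have h3 : ∑ x, g x = ∑ x, H.deg x + 1 := by
      have h4 : ∑ x ∈ Finset.univ.erase u, H.deg x = ∑ x ∈ Finset.univ.erase u, g x :=
        Finset.sum_congr rfl fun x hx => h1 x (Finset.ne_of_mem_erase hx)
      rw [← Finset.add_sum_erase _ (fun x => g x) (Finset.mem_univ u),
        ← Finset.add_sum_erase _ (fun x => H.deg x) (Finset.mem_univ u), h4]
      omega
    rw [h3, sum_deg] at heven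
    grind
  have hnadj : ∀ x y, H.deg x < g x → H.deg y < g y → x ≠ y → H.Adj x y := by
    intro x y hx hy hxy
    by_contra hadj
    exact hmax' _ x y hx hy (fun h => absurd h hxy) (deg_sup_edge hxy hadj)
  obtain ⟨z, hzL, hz⟩ : ∃ z ∈ L, z ∉ insert u (H.nbhd u) := by
    by_contra! hcon
    have h1 := Finset.card_le_card (show L ⊆ insert u (H.nbhd u) from hcon)
    have h2 := Finset.card_insert_le u (H.nbhd u)
    rw [card_nbhd] at h2
    have := hg u
    omega
  simp only [Finset.mem_insert, mem_nbhd, not_or] at hz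
  have hzdeg : H.deg z = g z := by
    by_contra hne
    exact hz.2 (hnadj u z hu (lt_of_le_of_ne (hH z) hne) (Ne.symm hz.1))
  have hzw : ∀ w, H.Adj z w → w ≠ v → H.Adj v w := by
    intro w hw hwv
    by_contra hvw
    refine hmax' ((H \ edge z w) ⊔ edge u z ⊔ edge v w) u v hu hv huv fun x => ?_
    have hne := hw.ne
    have huw : u ≠ w := by rintro rfl; exact hz.2 hw.symm
    rw [deg_sup_edge (Ne.symm hwv), deg_sup_edge (Ne.symm hz.1)]
    · have := deg_sdiff_edge hw x
      omega
    · simp [hz.2]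
    · simp only [sup_adj, sdiff_adj, edge_adj]
      grind
  have hgz := hL z hzL
  have hgv := hg v
  by_cases huv' : u = v
  · subst huv'
    have := huv rfl
    have : H.deg z ≤ H.deg u := by
      rw [← card_nbhd, ← card_nbhd]
      refine Finset.card_le_card fun w hw => ?_
      rw [mem_nbhd] at hw ⊢
      exact hzw w hw (by rintro rfl; exact hz.2 hw.symm)
    omega
  · have hadj := hnadj u v hu hv huv'
    have hsub : ((H.nbhd z).erase v).card ≤
        (((H.nbhd v).erase z).erase u).card := by
      refine Finset.card_le_card fun w hw => ?_
      simp only [Finset.mem_erase, mem_nbhd] at hw ⊢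
      exact ⟨by rintro rfl; exact hz.2 hw.2.symm, hw.2.ne', hzw w hw.2 hw.1⟩
    have hu' : u ∈ (H.nbhd v).erase z := by
      simp [Ne.symm hz.1, hadj.symm]
    have hpos := Finset.card_pos.2 ⟨u, hu'⟩
    rw [Finset.card_erase_of_mem hu'] at hsub
    rw [Finset.card_erase_eq_ite, Finset.card_erase_eq_ite, card_nbhd,
      card_nbhd] at hsub
    rw [Finset.card_erase_eq_ite, card_nbhd] at hpos
    simp only [mem_nbhd, H.adj_comm v z] at hsub hpos
    split_ifs at hsub hpos <;> omega

theorem exists_adj_of_card_ge_three (f : V → ℕ) (v : V) (S : Finset V) (hcard : 3 ≤ S.card)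
    {u₁ u₂ : V} (hu₁ : u₁ ∈ S) (hu₂ : u₂ ∈ S) (h₁₂ : u₁ ≠ u₂) (hf₁ : 2 ≤ f u₁) (hf₂ : 2 ≤ f u₂)
    (htop : ∀ u ∈ S, ∀ w, w ∉ S → w ≠ v → f w ≤ f u)
    (hf : ∃ G : SimpleGraph V, (∀ x, G.deg x = f x) ∧ ∀ x, G.Adj v x ↔ x ∈ S) :
    ∃ G : SimpleGraph V, (∀ x, G.deg x = f x) ∧ (∀ x, G.Adj v x ↔ x ∈ S) ∧
      ∃ x ∈ S, ∃ y ∈ S, G.Adj x y := by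
  by_contra! hcon
  obtain ⟨G, hG, hN⟩ := hf
  have hind := hcon G hG hN
  have hadj : ∀ u ∈ S, ∀ u' ∈ S, u ≠ u' → ∀ w w', G.Adj u w → G.Adj u' w' → w ≠ v → w' ≠ v →
      w ≠ w' → G.Adj w w' := by
    intro u hu u' hu' huu w w' hw hw' hwv hwv' hww
    by_contra hne
    obtain ⟨G', hdeg, hadj⟩ := exists_switch hw hw' (hind u hu u' hu') hne huu hww
    refine hcon G' (fun x => by rw [hdeg, hG]) (fun x => ?_) u hu u' hu' (by rw [hadj]; simp)
    have h1 : u ≠ v := ((hN u).2 hu).ne'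
    have h2 : u' ≠ v := ((hN u').2 hu').ne'
    rw [hadj, ← hN]
    simp only [ne_eq, Sym2.eq_iff]
    grind
  have hle : ∀ u ∈ S, ∀ w, G.Adj u w → w ≠ v → ∀ u' ∈ S, G.deg w ≤ G.deg u' := by
    intro u hu w hw hwv u' hu'
    rw [hG, hG]
    exact htop u' hu' w (fun h => hind u hu w h hw) hwv
  have hbig : ∀ u ∈ S, ∀ w, G.Adj u w → w ≠ v →
      (∀ z, G.Adj u z → z ≠ v → z ≠ w → G.Adj w z) → ∀ y y', y ≠ y' → G.Adj w y → G.Adj w y' →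
      ¬G.Adj u y → ¬G.Adj u y' → y ≠ u → y' ≠ u → False := by
    intro u hu w hw hwv hz y y' hyy hy hy' huy huy' hyu hyu'
    have hsub : insert y (insert y' (insert u (((G.nbhd u).erase v).erase w))) ⊆ G.nbhd w := by
      intro z hz'
      simp only [Finset.mem_insert, Finset.mem_erase, mem_nbhd] at hz' ⊢
      rcases hz' with rfl | rfl | rfl | h
      · exact hy
      · exact hy'
      · exact hw.symm
      · exact hz z h.2.2 h.2.1 h.1
    have h1 := Finset.card_le_card hsub
    rw [Finset.card_insert_of_notMem (by simp [hyy, hyu, huy]),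
      Finset.card_insert_of_notMem (by simp [hyu', huy']),
      Finset.card_insert_of_notMem (by simp),
      Finset.card_erase_of_mem (by simp [hw, hwv]),
      Finset.card_erase_of_mem (by simpa using ((hN u).2 hu).symm), card_nbhd, card_nbhd] at h1
    have h2 := hle u hu w hw hwv u hu
    omega
  have heq : ∀ u ∈ S, ∀ u' ∈ S, u ≠ u' → ∀ w, G.Adj u w → w ≠ v → ¬G.Adj u' w →
      insert u ((G.nbhd u').erase v) = G.nbhd w := by
    intro u hu u' hu' huu w hw hwv hw'
    apply Finset.eq_of_subset_of_card_le
    · intro z hz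
      simp only [Finset.mem_insert, Finset.mem_erase, mem_nbhd] at hz ⊢
      rcases hz with rfl | h
      · exact hw.symm
      · exact hadj u hu u' hu' huu w z hw h.2 hwv h.1 (by rintro rfl; exact hw' h.2)
    · rw [Finset.card_insert_of_notMem (by simp [hind u' hu' u hu]),
        Finset.card_erase_of_mem (by simpa using ((hN u').2 hu').symm), card_nbhd, card_nbhd]
      have := hle u hu w hw hwv u' hu'
      omega
  have hex : ∀ u, 2 ≤ f u → ∃ w, G.Adj u w ∧ w ≠ v := by
    intro u hu
    have h1 : 1 < (G.nbhd u).card := by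
      rw [card_nbhd, hG]
      exact hu
    obtain ⟨w, hw, hwv⟩ := Finset.exists_mem_ne h1 v
    exact ⟨w, by simpa using hw, hwv⟩
  obtain ⟨u₃, hu₃, hu₃'⟩ : ∃ u₃ ∈ S, u₃ ∉ ({u₁, u₂} : Finset V) :=
    Finset.exists_mem_notMem_of_card_lt_card (by rw [Finset.card_pair h₁₂]; omega)
  simp only [Finset.mem_insert, Finset.mem_singleton, not_or] at hu₃'
  have h₁₃ : u₁ ≠ u₃ := Ne.symm hu₃'.1
  have h₂₃ : u₂ ≠ u₃ := Ne.symm hu₃'.2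
  obtain ⟨w, hw, hwv⟩ := hex u₁ hf₁
  by_cases h2 : G.Adj u₂ w
  · by_cases h3 : G.Adj u₃ w
    · exact hbig u₂ hu₂ w h2 hwv
        (fun z hz hzv hzw => hadj u₁ hu₁ u₂ hu₂ h₁₂ w z hw hz hwv hzv hzw.symm) u₁ u₃ h₁₃
        hw.symm h3.symm (hind _ hu₂ _ hu₁) (hind _ hu₂ _ hu₃) h₁₂ h₂₃.symm
    · have h4 : u₂ ∈ insert u₁ ((G.nbhd u₃).erase v) := by
        rw [heq u₁ hu₁ u₃ hu₃ h₁₃ w hw hwv h3]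
        simpa using h2.symm
      simp only [Finset.mem_insert, Finset.mem_erase, mem_nbhd] at h4
      rcases h4 with h4 | h4
      · exact h₁₂ h4.symm
      · exact hind _ hu₃ _ hu₂ h4.2
  · have e2 := heq u₁ hu₁ u₂ hu₂ h₁₂ w hw hwv h2
    have h3 : ¬G.Adj u₃ w := by
      intro h3
      have h4 : u₃ ∈ insert u₁ ((G.nbhd u₂).erase v) := by
        rw [e2]
        simpa using h3.symm
      simp only [Finset.mem_insert, Finset.mem_erase, mem_nbhd] at h4
      rcases h4 with h4 | h4
      · exact h₁₃ h4.symm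
      · exact hind _ hu₂ _ hu₃ h4.2
    have e3 := heq u₁ hu₁ u₃ hu₃ h₁₃ w hw hwv h3
    obtain ⟨w', hw', hwv'⟩ := hex u₂ hf₂
    have hmem : w' ∈ G.nbhd w := by
      rw [← e2]
      simp [hw', hwv']
    have hw3 : G.Adj u₃ w' := by
      rw [← e3] at hmem
      simp only [Finset.mem_insert, Finset.mem_erase, mem_nbhd] at hmem
      rcases hmem with rfl | h
      · exact absurd hw' (hind _ hu₂ _ hu₁)
      · exact h.2
    refine hbig u₂ hu₂ w' hw' hwv'
        (fun z hz hzv hzw => hadj u₃ hu₃ u₂ hu₂ h₂₃.symm w' z hw3 hz hwv' hzv hzw.symm) u₃ w ?_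
        hw3.symm (by simpa using (mem_nbhd.1 hmem).symm) (hind _ hu₂ _ hu₃) h2 h₂₃.symm ?_
    · rintro rfl
      exact hind _ hu₁ _ hu₃ hw
    · rintro rfl
      exact hind _ hu₁ _ hu₂ hw

theorem exists_adj_of_adj_of_le (f : V → ℕ) (v : V) (S : Finset V) {x w u : V}
    (hx : x ∈ S) (hw : w ∈ S) (hu : u ∈ S) (hxu : x ≠ u) (hwu : f w ≤ f u)
    (hf : ∃ G : SimpleGraph V, (∀ x, G.deg x = f x) ∧ (∀ x, G.Adj v x ↔ x ∈ S) ∧ G.Adj x w) :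
    ∃ G : SimpleGraph V, (∀ x, G.deg x = f x) ∧ (∀ x, G.Adj v x ↔ x ∈ S) ∧ G.Adj x u := by
  obtain ⟨G, hG, hN, hxw⟩ := hf
  by_cases hadj : G.Adj x u
  · exact ⟨G, hG, hN, hadj⟩
  obtain ⟨z, hz, hwz, hzw⟩ := exists_adj_not_adj hxw hadj hxu (by rw [hG, hG]; exact hwu)
  obtain ⟨G', hdeg, hadj'⟩ := exists_switch hxw hz hadj hwz hxu hzw.symm
  refine ⟨G', fun y => by rw [hdeg, hG], fun y => ?_, by rw [hadj']; simp⟩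
  have h1 : x ≠ v := ((hN x).2 hx).ne'
  have h2 : w ≠ v := ((hN w).2 hw).ne'
  have h3 : u ≠ v := ((hN u).2 hu).ne'
  have h4 : z ≠ v := by rintro rfl; exact hwz ((hN w).2 hw).symm
  rw [hadj', ← hN]
  simp only [ne_eq, Sym2.eq_iff]
  grind

theorem exists_triangle (f : V → ℕ) (a : ℕ → V)
    (hinj : ∀ i j, i ≤ 2 → j ≤ 2 → a i = a j → i = j)
    (hmono : ∀ i j, i ≤ j → j ≤ 2 → f (a j) ≤ f (a i))
    (hout : ∀ x, (∀ i ≤ 2, x ≠ a i) → f x ≤ f (a 2))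
    (h0 : 3 ≤ f (a 0)) (h2 : 2 ≤ f (a 2))
    (hf : ∃ G : SimpleGraph V, ∀ x, G.deg x = f x) :
    ∃ G : SimpleGraph V, (∀ x, G.deg x = f x) ∧
      ∀ i j, i < j → j ≤ 2 → G.Adj (a i) (a j) := by
  have h01 : a 0 ≠ a 1 := fun h => by simpa using hinj 0 1 (by omega) (by omega) h
  have h02 : a 0 ≠ a 2 := fun h => by simpa using hinj 0 2 (by omega) (by omega) h
  have h12 : a 1 ≠ a 2 := fun h => by simpa using hinj 1 2 (by omega) (by omega) h
  have f12 := hmono 1 2 (by omega) le_rfl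
  have hout' : ∀ x, x ≠ a 0 → x ≠ a 1 → x ≠ a 2 → f x ≤ f (a 2) := by
    intro x h0 h1 h2
    refine hout x fun i hi => ?_
    interval_cases i <;> assumption
  have hlt : f (a 0) < Fintype.card V := by
    obtain ⟨G, hG⟩ := hf
    rw [← hG]
    exact G.deg_lt_card _
  obtain ⟨S, hsub, hvS, hS, htop⟩ := exists_top_set f (a 0) {a 1, a 2} (f (a 0))
    (by simp [h01, h02]) (by rw [Finset.card_pair h12]; omega) hlt (by
      intro u hu w hw hw0
      simp only [Finset.mem_insert, Finset.mem_singleton, not_or] at hu hw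
      have := hout' w hw0 hw.1 hw.2
      rcases hu with rfl | rfl <;> omega)
  have hS1 : a 1 ∈ S := hsub (by simp)
  have hS2 : a 2 ∈ S := hsub (by simp)
  have hmem : ∀ x ∈ S, x ≠ a 0 := fun x hx h => hvS (h ▸ hx)
  have hle : ∀ x ∈ S, x ≠ a 1 → f x ≤ f (a 2) := by
    intro x hx hx1
    by_cases hx2 : x = a 2
    · rw [hx2]
    · exact hout' x (hmem x hx) hx1 hx2
  obtain ⟨G, hG, hN, x, hx, y, hy, hxy⟩ := exists_adj_of_card_ge_three f (a 0) S (by omega)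
    hS1 hS2 h12 (h2.trans f12) h2 htop
    (exists_realization_adj_iff_mem f (a 0) S hvS hS htop hf)
  obtain ⟨t, ht, ht1, hGt⟩ : ∃ t ∈ S, t ≠ a 1 ∧ ∃ G : SimpleGraph V, (∀ x, G.deg x = f x) ∧
      (∀ x, G.Adj (a 0) x ↔ x ∈ S) ∧ G.Adj (a 1) t := by
    by_cases hx1 : x = a 1
    · subst hx1
      exact ⟨y, hy, hxy.ne', G, hG, hN, hxy⟩
    · obtain ⟨G', hG', hN', hadj⟩ := exists_adj_of_adj_of_le f (a 0) S hx hy hS1 hx1 (by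
        by_cases hy1 : y = a 1
        · rw [hy1]
        · exact (hle y hy hy1).trans f12) ⟨G, hG, hN, hxy⟩
      exact ⟨x, hx, hx1, G', hG', hN', hadj.symm⟩
  obtain ⟨G', hG', hN', hadj⟩ :=
    exists_adj_of_adj_of_le f (a 0) S hS1 ht hS2 h12 (hle t ht ht1) hGt
  refine ⟨G', hG', fun i j hij hj => ?_⟩
  interval_cases j <;> interval_cases i
  · exact (hN' _).2 hS1
  · exact (hN' _).2 hS2
  · exact hadj

theorem exists_levelled_attachment (f : V → ℕ) (A P : Finset V) (p r : ℕ) (hr : 1 ≤ r)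
    (hA : A.card = r + 1) (hpA : ∀ b ∈ A, p ≤ f b) (hp : ∃ b ∈ A, f b = p)
    (hout : ∀ x, x ∉ A → f x ≤ p) (hrp : r ≤ p) (hP : Disjoint P A) (hPf : ∀ x ∈ P, f x = p)
    (hPr : r + 1 ≤ P.card) (hPA : ∀ b ∈ A, f b + 1 ≤ r + P.card) :
    ∃ N, IsAttachment A (fun b => f b - r) N ∧ ∃ (g : V → ℕ) (h : ℕ) (L : Finset V),
      (∀ y, y ∉ A → (f y : ℤ) = g y + coverCount A N y) ∧ (∀ b ∈ A, g b = 0) ∧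
      (∀ x, g x ≤ h) ∧ (∀ x ∈ L, h ≤ g x + 1) ∧ h + 1 ≤ L.card := by
  obtain ⟨N, hN, hbal⟩ := exists_balanced_attachment (fun x => (f x : ℤ)) A P (fun b => f b - r) hP
    (fun b hb => by have := hPA b hb; omega)
  refine ⟨N, hN, ?_⟩
  have hPA' : ∀ x ∈ P, x ∉ A := fun x hx => Finset.disjoint_left.1 hP hx
  have hNc : ∀ b ∈ A, (N b).card = f b - r := fun b hb => (hN b hb).1
  have hNA : ∀ b ∈ A, ∀ y ∈ N b, y ∉ A := fun b hb y hy => Finset.disjoint_left.1 (hN b hb).2 hy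
  set g : V → ℤ := fun x => f x - coverCount A N x with hg
  have hgx : ∀ x, g x = f x - coverCount A N x := fun x => rfl
  have hmove : ∀ b ∈ A, ∀ x y, y ∈ N b → x ∉ N b → x ∉ A → g x ≤ g y + 1 := by
    intro b hb x y hy hx hxA
    exact hbal _ (hN.shift hy hx hxA) x y hxA (hNA b hb y hy) (by rintro rfl; exact hx hy)
      (coverCount_shift hb hy hx)
  have hPne : P.Nonempty := Finset.card_pos.1 (by omega)
  obtain ⟨x₀, hx₀, hmax⟩ := Finset.exists_max_image Aᶜ g
    (by obtain ⟨x, hx⟩ := hPne; exact ⟨x, by simpa using hPA' x hx⟩)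
  simp only [Finset.mem_compl] at hx₀ hmax
  have hx₀p := hout x₀ hx₀
  have hPL : ∀ x ∈ P, g x₀ ≤ g x + 1 := by
    intro x hx
    by_contra! hlt
    have hlt' : coverCount A N x₀ < coverCount A N x := by
      have := hPf x hx
      rw [hgx, hgx] at hlt
      omega
    obtain ⟨b, hb, hxb, hx₀b⟩ := exists_mem_of_coverCount_lt hlt'
    have := hmove b hb x₀ x hxb hx₀b hx₀
    omega
  have hNL : ∀ b ∈ A, ∀ y ∈ N b, g x₀ ≤ g y + 1 := by
    intro b hb y hy
    by_contra! hlt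
    have hx₀b : x₀ ∈ N b := by
      by_contra hx₀b
      have := hmove b hb x₀ y hy hx₀b hx₀
      omega
    obtain ⟨x, hxP, hxb⟩ : ∃ x ∈ P, x ∉ N b := by
      apply Finset.exists_mem_notMem_of_card_lt_card
      have := hPA b hb
      rw [hNc b hb]
      omega
    have h1 := hmove b hb x y hy hxb (hPA' x hxP)
    have hlt' : coverCount A N x₀ < coverCount A N x := by
      have := hPf x hxP
      rw [hgx x₀, hgx y] at hlt
      rw [hgx, hgx] at h1
      omega
    obtain ⟨b', hb', hxb', hx₀b'⟩ := exists_mem_of_coverCount_lt hlt'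
    have hbb : b' ≠ b := by rintro rfl; exact hxb hxb'
    have hshift : shift N b y x b' = N b' := Function.update_of_ne hbb _ _
    have h2 := hbal (shift (shift N b y x) b' x x₀)
      ((hN.shift hy hxb (hPA' x hxP)).shift (by rwa [hshift]) (by rwa [hshift]) hx₀) x₀ y hx₀
      (hNA b hb y hy) (by rintro rfl; omega) (fun z => by
        rw [coverCount_shift hb' (by rwa [hshift]) (by rwa [hshift]), coverCount_shift hb hy hxb]
        ring)
    rw [hgx, hgx] at hlt
    omega
  have hsum : ∀ b ∈ A, ((f b - r : ℕ) : ℤ) = f b - r := by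
    intro b hb
    have := hpA b hb
    omega
  have hcast : ∀ b ∈ A, ((N b).card : ℤ) = f b - r := fun b hb => by rw [hNc b hb, hsum b hb]
  have hnonneg : ∀ y, y ∉ A → 0 ≤ g y := by
    intro y hy
    by_contra! hneg
    have hx₀' : g x₀ ≤ 0 := by
      have h1 : 0 < coverCount A N y := by
        rw [hgx] at hneg
        omega
      obtain ⟨b, hb, hlt⟩ := Finset.exists_lt_of_sum_lt
        (show ∑ b ∈ A, (0 : ℤ) < coverCount A N y by simpa using h1)
      have := hNL b hb y (by by_contra h; simp [h] at hlt)
      omega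
    have h1 : (P.card : ℤ) * p ≤ ∑ x ∈ P, coverCount A N x := by
      rw [← nsmul_eq_mul]
      refine Finset.card_nsmul_le_sum _ _ _ fun x hx => ?_
      have h2 := hmax x (hPA' x hx)
      have h3 := hPf x hx
      rw [hgx x] at h2
      omega
    obtain ⟨b, hb, hbp⟩ := hp
    have h2 : ∑ x ∈ P, coverCount A N x ≤ (p - r) + r * (P.card - 1) := by
      rw [sum_coverCount, ← Finset.add_sum_erase _ _ hb]
      have h3 : ((P ∩ N b).card : ℤ) ≤ p - r := by
        rw [← hbp, ← hcast b hb]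
        exact_mod_cast Finset.card_le_card Finset.inter_subset_right
      have h4 : ∑ b ∈ A.erase b, ((P ∩ N b).card : ℤ) ≤ (A.erase b).card • ((P.card : ℤ) - 1) := by
        refine Finset.sum_le_card_nsmul _ _ _ fun b' hb' => ?_
        have hb'' := Finset.mem_of_mem_erase hb'
        have h5 : ((P ∩ N b').card : ℤ) ≤ (N b').card := by
          exact_mod_cast Finset.card_le_card Finset.inter_subset_right
        rw [hcast b' hb''] at h5
        have := hPA b' hb''
        omega
      rw [Finset.card_erase_of_mem hb, hA, Nat.add_sub_cancel, nsmul_eq_mul] at h4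
      linarith
    have h3 : (r : ℤ) ≤ p := by exact_mod_cast hrp
    have h4 : (r : ℤ) + 1 ≤ P.card := by exact_mod_cast hPr
    have h5 : (1 : ℤ) ≤ r := by exact_mod_cast hr
    nlinarith [mul_nonneg (sub_nonneg.2 h3) (show (0 : ℤ) ≤ P.card - 1 by linarith)]
  set L : Finset V := Aᶜ.filter fun y => g x₀ ≤ g y + 1 with hL
  have hsize : g x₀ + 1 ≤ L.card := by
    by_contra! hlt
    have hPLc : P.card ≤ L.card := Finset.card_le_card fun x hx => by
      simp [hL, hPA' x hx, hPL x hx]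
    have h1 : ∑ x ∈ L, coverCount A N x = ∑ b ∈ A, ((f b : ℤ) - r) := by
      rw [sum_coverCount]
      refine Finset.sum_congr rfl fun b hb => ?_
      rw [← hcast b hb, Finset.inter_eq_right.2]
      intro y hy
      simp [hL, hNA b hb y hy, hNL b hb y hy]
    have h2 : ((r : ℤ) + 1) * (p - r) ≤ ∑ x ∈ L, coverCount A N x := by
      have := Finset.card_nsmul_le_sum A (fun b => (f b : ℤ) - r) (p - r) (fun b hb => by
        have := hpA b hb
        omega)
      rw [hA, nsmul_eq_mul] at this
      rw [h1]
      exact_mod_cast this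
    have h3 : ∑ x ∈ L, (f x : ℤ) ≤ L.card * p := by
      rw [← nsmul_eq_mul]
      refine Finset.sum_le_card_nsmul _ _ _ fun x hx => ?_
      exact_mod_cast hout x (by simp [hL] at hx; exact hx.1)
    have hx₀L : x₀ ∈ L := by simp [hL, hx₀]
    have h4 : (L.card : ℤ) * (g x₀ - 1) + 1 ≤ ∑ x ∈ L, g x := by
      rw [← Finset.add_sum_erase _ _ hx₀L]
      have h5 := Finset.card_nsmul_le_sum (L.erase x₀) g (g x₀ - 1) (fun x hx => by
        have := Finset.mem_of_mem_erase hx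
        simp only [hL, Finset.mem_filter] at this
        linarith [this.2])
      rw [Finset.card_erase_of_mem hx₀L, nsmul_eq_mul,
        Nat.cast_sub (Finset.card_pos.2 ⟨_, hx₀L⟩)] at h5
      push_cast at h5
      linarith
    have h5 : ∑ x ∈ L, g x = ∑ x ∈ L, (f x : ℤ) - ∑ x ∈ L, coverCount A N x := by
      rw [← Finset.sum_sub_distrib]
    obtain ⟨b, hb, hbp⟩ := hp
    have h6 := hPA b hb
    have h7 : (0 : ℤ) ≤ (L.card : ℤ) - (p - r) := by omega
    have h8 : (0 : ℤ) ≤ (L.card : ℤ) - (r + 1) := by omega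
    have h9 : (L.card : ℤ) ≤ g x₀ := by omega
    have h10 : (0 : ℤ) ≤ L.card := by positivity
    nlinarith [mul_nonneg h7 h8, mul_nonneg h10 (sub_nonneg.2 h9)]
  refine ⟨fun x => if x ∈ A then 0 else (g x).toNat, (g x₀).toNat, L, ?_, ?_, ?_, ?_, ?_⟩
  · intro y hy
    have := hnonneg y hy
    beta_reduce
    rw [if_neg hy, Int.toNat_of_nonneg this, hgx]
    ring
  · intro b hb
    simp [hb]
  · intro x
    beta_reduce
    split_ifs with hx
    · exact Nat.zero_le _
    · exact Int.toNat_le_toNat (hmax x hx)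
  · intro x hx
    simp only [hL, Finset.mem_filter, Finset.mem_compl] at hx
    have := hx.2
    beta_reduce
    rw [if_neg hx.1]
    omega
  · have := hnonneg x₀ hx₀
    omega

/-- If enough vertices outside `A` share the least value `p` taken on `A`, then `f` has a
realization in which `A` is a clique. -/
theorem exists_clique_of_many_ties (f : V → ℕ) (A P : Finset V) (p r : ℕ) (hr : 1 ≤ r)
    (hA : A.card = r + 1) (hpA : ∀ b ∈ A, p ≤ f b) (hp : ∃ b ∈ A, f b = p)
    (hout : ∀ x, x ∉ A → f x ≤ p) (hrp : r ≤ p) (hP : Disjoint P A) (hPf : ∀ x ∈ P, f x = p)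
    (hPr : r + 1 ≤ P.card) (hPA : ∀ b ∈ A, f b + 1 ≤ r + P.card) (heven : Even (∑ x, f x)) :
    ∃ G : SimpleGraph V, (∀ x, G.deg x = f x) ∧ ∀ x ∈ A, ∀ y ∈ A, x ≠ y → G.Adj x y := by
  obtain ⟨N, hN, g, h, L, hfg, hgA, hgh, hL, hcard⟩ := exists_levelled_attachment f A P p r hr hA
    hpA hp hout hrp hP hPf hPr hPA
  have hNc : ∀ b ∈ A, (N b).card = f b - r := fun b hb => (hN b hb).1
  have hNA : ∀ b ∈ A, ∀ y ∈ N b, y ∉ A := fun b hb y hy => Finset.disjoint_left.1 (hN b hb).2 hy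
  have hfb : ∀ b ∈ A, f b = (f b - r) + r := fun b hb => by
    have := hpA b hb
    omega
  have hsumg : Even (∑ x, g x) := by
    have h1 : ∑ x ∈ Aᶜ, coverCount A N x = ∑ b ∈ A, ((f b - r : ℕ) : ℤ) := by
      rw [sum_coverCount]
      refine Finset.sum_congr rfl fun b hb => ?_
      rw [← hNc b hb, Finset.inter_eq_right.2]
      intro y hy
      simpa using hNA b hb y hy
    have h2 : ∑ x ∈ Aᶜ, (f x : ℤ) = ∑ x ∈ Aᶜ, (g x : ℤ) + ∑ b ∈ A, ((f b - r : ℕ) : ℤ) := by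
      rw [← h1, ← Finset.sum_add_distrib]
      exact Finset.sum_congr rfl fun x hx => hfg x (by simpa using hx)
    have h3 : ∑ x ∈ Aᶜ, f x = ∑ x ∈ Aᶜ, g x + ∑ b ∈ A, (f b - r) := by exact_mod_cast h2
    have h4 : ∑ b ∈ A, f b = ∑ b ∈ A, (f b - r) + (r + 1) * r := by
      rw [Finset.sum_congr rfl hfb, Finset.sum_add_distrib, Finset.sum_const, hA, smul_eq_mul]
    have h5 : ∑ b ∈ A, g b = 0 := Finset.sum_eq_zero hgA
    have h6 : Even ((r + 1) * r) := by
      rw [mul_comm]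
      exact Nat.even_mul_succ_self r
    rw [← Finset.sum_add_sum_compl A, h3, h4] at heven
    rw [← Finset.sum_add_sum_compl A, h5]
    grind
  obtain ⟨H, hH⟩ := exists_deg_eq_of_near_regular g h L hgh hL hcard hsumg
  have hHA : ∀ b ∈ A, ∀ y, ¬H.Adj b y := by
    intro b hb y hy
    have := deg_pos_iff.2 ⟨y, hy⟩
    rw [hH, hgA b hb] at this
    omega
  let K : SimpleGraph V := SimpleGraph.fromRel fun x y => x ∈ A ∧ (y ∈ A ∨ y ∈ N x)
  have hK : ∀ x y, K.Adj x y ↔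
      x ≠ y ∧ ((x ∈ A ∧ (y ∈ A ∨ y ∈ N x)) ∨ (y ∈ A ∧ (x ∈ A ∨ x ∈ N y))) := fun x y => by
    simp only [K, fromRel_adj]
  refine ⟨H ⊔ K, fun x => ?_, fun x hx y hy hxy => Or.inr ((hK x y).2 ⟨hxy, by grind⟩)⟩
  rw [deg_sup_of_disjoint, hH]
  · by_cases hx : x ∈ A
    · have h1 : K.nbhd x = A.erase x ∪ N x := by
        ext y
        rw [mem_nbhd, hK, Finset.mem_union, Finset.mem_erase]
        grind
      rw [← card_nbhd, h1, Finset.card_union_of_disjoint, Finset.card_erase_of_mem hx, hA, hgA x hx,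
        hNc x hx]
      · have := hfb x hx
        omega
      · exact (hN x hx).2.symm.mono_left (Finset.erase_subset _ _)
    · have h1 : K.nbhd x = A.filter fun b => x ∈ N b := by
        ext y
        rw [mem_nbhd, hK, Finset.mem_filter]
        grind
      have h2 : (K.deg x : ℤ) = coverCount A N x := by
        rw [← card_nbhd, h1, coverCount, Finset.sum_boole]
      have := hfg x hx
      omega
  · rw [disjoint_left]
    intro x y hxy hxy'
    rcases ((hK x y).1 hxy').2 with h1 | h1
    · exact hHA x h1.1 y hxy
    · exact hHA y h1.1 x hxy.symm

/-- Let `a 0, …, a r` carry the `r + 1` largest values of a degree function `f`, with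
`f (a r) ≥ r`, `f (a (r - 2)) ≥ r + 1` and `f (a i) ≥ 2 * r - i` for `i ≤ r - 3`. Then `f` has
a realization in which these vertices form a clique. -/
theorem exists_clique_of_slack (r : ℕ) (hr : 2 ≤ r) : ∀ (f : V → ℕ) (a : ℕ → V),
    (∀ i j, i ≤ r → j ≤ r → a i = a j → i = j) →
    (∀ i j, i ≤ j → j ≤ r → f (a j) ≤ f (a i)) →
    (∀ x, (∀ i ≤ r, x ≠ a i) → f x ≤ f (a r)) →
    r ≤ f (a r) → r + 1 ≤ f (a (r - 2)) → (∀ i, i + 3 ≤ r → 2 * r ≤ f (a i) + i) →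
    (∃ G : SimpleGraph V, ∀ x, G.deg x = f x) →
    ∃ G : SimpleGraph V, (∀ x, G.deg x = f x) ∧
      ∀ i j, i < j → j ≤ r → G.Adj (a i) (a j) := by
  induction r, hr using Nat.le_induction with
  | base =>
    intro f a hinj hmono hout hlast hmid _ hf
    exact exists_triangle f a hinj hmono hout hmid hlast hf
  | succ r hr ih =>
    intro f a hinj hmono hout hlast hmid hslack hf
    have hzero : 2 * (r + 1) ≤ f (a 0) := by simpa using hslack 0 (by omega)
    have hlt : f (a 0) < Fintype.card V := by
      obtain ⟨G, hG⟩ := hf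
      rw [← hG]
      exact G.deg_lt_card _
    set S₀ : Finset V := (Finset.Icc 1 (r + 1)).image a with hS₀
    have hmem₀ : ∀ x, x ∈ S₀ ↔ ∃ i, 1 ≤ i ∧ i ≤ r + 1 ∧ a i = x := by
      intro x
      simp [hS₀, and_assoc]
    have hcard₀ : S₀.card = r + 1 := by
      rw [hS₀, Finset.card_image_of_injOn, Nat.card_Icc, Nat.add_sub_cancel]
      intro i hi j hj hij
      simp only [Finset.coe_Icc, Set.mem_Icc] at hi hj
      exact hinj i j hi.2 hj.2 hij
    have hv₀ : a 0 ∉ S₀ := by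
      rw [hmem₀]
      rintro ⟨i, hi, hi', h⟩
      have := hinj i 0 hi' (by omega) h
      omega
    have hout₀ : ∀ x, x ∉ S₀ → x ≠ a 0 → f x ≤ f (a (r + 1)) := by
      intro x hx hx0
      refine hout x fun i hi => ?_
      rintro rfl
      rcases Nat.eq_zero_or_pos i with rfl | hpos
      · exact hx0 rfl
      · exact hx ((hmem₀ _).2 ⟨i, hpos, hi, rfl⟩)
    obtain ⟨S, hsub, hvS, hS, htop⟩ := exists_top_set f (a 0) S₀ (f (a 0)) hv₀ (by omega) hlt (by
      intro u hu w hw hw0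
      obtain ⟨i, hi, hi', rfl⟩ := (hmem₀ u).1 hu
      exact (hout₀ w hw hw0).trans (hmono i (r + 1) hi' le_rfl))
    have hmemS : ∀ i, 1 ≤ i → i ≤ r + 1 → a i ∈ S := fun i hi hi' =>
      hsub ((hmem₀ _).2 ⟨i, hi, hi', rfl⟩)
    by_cases hcase : ∀ x, x ∉ S → x ≠ a 0 → f x < f (a (r + 1))
    · obtain ⟨hres, hext⟩ := residual_realizable f (a 0) S hvS hS htop hf
      have hval : ∀ i, i ≤ r → residualDegree f (a 0) S (a (i + 1)) = f (a (i + 1)) - 1 := by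
        intro i hi
        have hm := hmemS (i + 1) (by omega) (by omega)
        rw [residualDegree, if_neg (fun h : a (i + 1) = a 0 => hvS (h ▸ hm)), if_pos hm]
      obtain ⟨H, hH, hHadj⟩ := ih (residualDegree f (a 0) S) (fun i => a (i + 1)) (by
          intro i j hi hj hij
          have := hinj (i + 1) (j + 1) (by omega) (by omega) hij
          omega) (by
          intro i j hij hj
          rw [hval i (by omega), hval j hj]
          have := hmono (i + 1) (j + 1) (by omega) (by omega)
          omega) (by
          intro x hx
          rw [hval r le_rfl, residualDegree]
          split_ifs with hx0 hxS
          · exact Nat.zero_le _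
          · refine Nat.sub_le_sub_right (hout₀ x (fun h => ?_) hx0) 1
            obtain ⟨i, hi, hi', rfl⟩ := (hmem₀ x).1 h
            exact hx (i - 1) (by omega) (by rw [Nat.sub_add_cancel hi])
          · have := hcase x hxS hx0
            omega) (by
          rw [hval r le_rfl]
          omega) (by
          rw [hval (r - 2) (by omega)]
          have h1 : r - 2 + 1 = r + 1 - 2 := by omega
          rw [h1]
          omega) (by
          intro i hi
          rw [hval i (by omega)]
          have := hslack (i + 1) (by omega)
          omega) hres
      obtain ⟨G, hG, hle, hGS⟩ := hext H hH
      refine ⟨G, hG, fun i j hij hj => ?_⟩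
      rcases Nat.eq_zero_or_pos i with rfl | hpos
      · exact hGS _ (hmemS j (by omega) hj)
      · have := hle (hHadj (i - 1) (j - 1) (by omega) (by omega))
        rwa [Nat.sub_add_cancel hpos, Nat.sub_add_cancel (by omega)] at this
    · push Not at hcase
      obtain ⟨x, hxS, hx0, hx⟩ := hcase
      have hAmem : ∀ y, y ∈ insert (a 0) S₀ ↔ ∃ i, i ≤ r + 1 ∧ a i = y := by
        intro y
        rw [Finset.mem_insert, hmem₀]
        constructor
        · rintro (rfl | ⟨i, -, hi, h⟩)
          · exact ⟨0, by omega, rfl⟩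
          · exact ⟨i, hi, h⟩
        · rintro ⟨i, hi, rfl⟩
          rcases Nat.eq_zero_or_pos i with rfl | hpos
          · exact Or.inl rfl
          · exact Or.inr ⟨i, hpos, hi, rfl⟩
      have hPcard : f (a 0) ≤ (insert x (S \ S₀)).card + r := by
        rw [Finset.card_insert_of_notMem (by simp [hxS]), Finset.card_sdiff_of_subset hsub, hS,
          hcard₀]
        omega
      have hPmem : ∀ y ∈ insert x (S \ S₀), y ∉ S₀ ∧ y ≠ a 0 := by
        intro y hy
        rw [Finset.mem_insert, Finset.mem_sdiff] at hy
        rcases hy with rfl | hy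
        · exact ⟨fun h => hxS (hsub h), hx0⟩
        · exact ⟨hy.2, fun h => hvS (h ▸ hy.1)⟩
      obtain ⟨G, hG, hadj⟩ := exists_clique_of_many_ties f (insert (a 0) S₀) (insert x (S \ S₀))
        (f (a (r + 1))) (r + 1) (by omega)
        (by rw [Finset.card_insert_of_notMem hv₀, hcard₀])
        (by
          intro b hb
          obtain ⟨i, hi, rfl⟩ := (hAmem b).1 hb
          exact hmono i (r + 1) hi le_rfl)
        ⟨a (r + 1), (hAmem _).2 ⟨r + 1, le_rfl, rfl⟩, rfl⟩
        (by
          intro y hy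
          rw [Finset.mem_insert, not_or] at hy
          exact hout₀ y hy.2 hy.1)
        hlast
        (by
          rw [Finset.disjoint_left]
          intro y hy hyA
          rw [Finset.mem_insert] at hyA
          exact hyA.elim (hPmem y hy).2 (hPmem y hy).1)
        (by
          intro y hy
          refine le_antisymm (hout₀ y (hPmem y hy).1 (hPmem y hy).2) ?_
          rw [Finset.mem_insert, Finset.mem_sdiff] at hy
          rcases hy with rfl | hy
          · exact hx
          · exact hx.trans (htop y hy.1 x hxS hx0))
        (by omega)
        (by
          intro b hb
          obtain ⟨i, hi, rfl⟩ := (hAmem b).1 hb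
          have := hmono 0 i (Nat.zero_le _) hi
          omega)
        (by
          obtain ⟨G, hG⟩ := hf
          rw [← Finset.sum_congr rfl fun x _ => hG x, sum_deg]
          exact even_two_mul _)
      refine ⟨G, hG, fun i j hij hj => hadj _ ((hAmem _).2 ⟨i, by omega, rfl⟩) _
        ((hAmem _).2 ⟨j, hj, rfl⟩) fun h => ?_⟩
      have := hinj i j (by omega) hj h
      omega

end SimpleGraph

/-- Lemma 3.2: let `r ≥ 3`, `n ≥ 2r` and `π = (d₁, ..., dₙ)` be an `n`-term graphic
sequence with `d_{r-2} ≥ r + 1`, `d_{r+1} ≥ r` and `d_r - 1 ≥ d_{d_{r+1}+2}`. If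
`d_i ≥ 2r - i` for `i = 1, 2, ..., r - 3`, then `π` is potentially `A_{r+1}`-graphic. -/
theorem stmt5 (r n : ℕ) (hr : 3 ≤ r) (hn : 2 * r ≤ n)
    (d : Fin n → ℕ) (hgraphic : IsGraphic d)
    (h1 : r + 1 ≤ nth d (r - 2)) (h2 : r ≤ nth d (r + 1))
    (h3 : nth d (nth d (r + 1) + 2) ≤ nth d r - 1)
    (h4 : ∀ i : ℕ, 1 ≤ i → i ≤ r - 3 → 2 * r - i ≤ nth d i) :
    PotentiallyA d r := by
  obtain ⟨hanti, G₀, hG₀⟩ := hgraphic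
  have hf : ∃ G : SimpleGraph (Fin n), ∀ x, G.deg x = d x :=
    ⟨G₀, fun x => by rw [deg_eq_degree]; exact hG₀ x⟩
  have hnth : ∀ i (hi : i < n), nth d (i + 1) = d ⟨i, hi⟩ := fun i hi => by simp [nth, hi]
  let a : ℕ → Fin n := fun i => if hi : i < n then ⟨i, hi⟩ else ⟨0, by omega⟩
  have ha : ∀ i, i ≤ r → ((a i : Fin n) : ℕ) = i := fun i hi => by
    simp only [a]
    rw [dif_pos (by omega)]
  have hinj : ∀ i j, i ≤ r → j ≤ r → a i = a j → i = j := fun i j hi hj h => by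
    rw [← ha i hi, ← ha j hj, h]
  have hmono : ∀ i j, i ≤ j → j ≤ r → d (a j) ≤ d (a i) := fun i j hij hj => by
    apply hanti
    rw [Fin.le_def, ha i (by omega), ha j hj]
    exact hij
  have hda : ∀ i, i ≤ r → nth d (i + 1) = d (a i) := fun i hi => by
    rw [hnth i (by omega)]
    exact congrArg d (Fin.ext (ha i hi).symm)
  have hindex : ∀ x : Fin n, (∀ i < r, x ≠ a i) → r ≤ (x : ℕ) := by
    intro x hx
    by_contra! hlt
    exact hx x hlt (Fin.ext (ha x (by omega)).symm)
  rw [hda r le_rfl] at h2 h3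
  have hdr : nth d r = d (a (r - 1)) := by
    rw [← hda (r - 1) (by omega), Nat.sub_add_cancel (by omega)]
  have hd3 : nth d (r - 2) = d (a (r - 3)) := by
    rw [← hda (r - 3) (by omega)]
    congr 1
    omega
  rw [hdr] at h3
  rw [hd3] at h1
  have hlast := hmono (r - 1) r (by omega) le_rfl
  have hlt : d (a r) < Fintype.card (Fin n) := by
    obtain ⟨G, hG⟩ := hf
    rw [← hG]
    exact G.deg_lt_card _
  set S₀ : Finset (Fin n) := (Finset.range r).image a with hS₀
  have hmem₀ : ∀ x, x ∈ S₀ ↔ ∃ i < r, a i = x := by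
    intro x
    simp [hS₀]
  have hcard₀ : S₀.card = r := by
    rw [hS₀, Finset.card_image_of_injOn, Finset.card_range]
    intro i hi j hj hij
    simp only [Finset.coe_range, Set.mem_Iio] at hi hj
    exact hinj i j hi.le hj.le hij
  have hv₀ : a r ∉ S₀ := by
    rw [hmem₀]
    rintro ⟨i, hi, h⟩
    have := hinj i r hi.le le_rfl h
    omega
  have hout₀ : ∀ x, x ∉ S₀ → d x ≤ d (a (r - 1)) := by
    intro x hx
    apply hanti
    rw [Fin.le_def, ha _ (by omega)]
    have := hindex x (fun i hi h => hx ((hmem₀ x).2 ⟨i, hi, h.symm⟩))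
    omega
  obtain ⟨S, hsub, hvS, hS, htop⟩ := exists_top_set d (a r) S₀ (d (a r)) hv₀ (by omega) hlt (by
    intro u hu w hw _
    obtain ⟨i, hi, rfl⟩ := (hmem₀ u).1 hu
    exact (hout₀ w hw).trans (hmono i (r - 1) (by omega) (by omega)))
  have hmemS : ∀ i < r, a i ∈ S := fun i hi => hsub ((hmem₀ _).2 ⟨i, hi, rfl⟩)
  have hstrict : ∀ x, x ∉ S → x ≠ a r → d x < d (a (r - 1)) := by
    intro x hxS hxr
    by_contra! hge
    have hxle : d x ≤ d (a r) := by
      apply hanti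
      rw [Fin.le_def, ha r le_rfl]
      refine hindex x fun i hi h => hxS ?_
      rw [h]
      exact hmemS i hi
    have hT : ∀ y ∈ insert (a r) (insert x S), d (a (r - 1)) ≤ d y := by
      intro y hy
      simp only [Finset.mem_insert] at hy
      rcases hy with rfl | rfl | hy
      · exact hge.trans hxle
      · exact hge
      · exact hge.trans (htop y hy x hxS hxr)
    have hTcard : (insert (a r) (insert x S)).card = d (a r) + 2 := by
      rw [Finset.card_insert_of_notMem (by simp [hvS, Ne.symm hxr]),
        Finset.card_insert_of_notMem hxS, hS]
    have hTn := Finset.card_le_univ (insert (a r) (insert x S))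
    rw [hTcard, Fintype.card_fin] at hTn
    obtain ⟨t, ht, ht'⟩ : ∃ t ∈ insert (a r) (insert x S),
        t ∉ Finset.univ.filter fun t : Fin n => (t : ℕ) < d (a r) + 1 := by
      apply Finset.exists_mem_notMem_of_card_lt_card
      rw [hTcard, Fin.card_filter_val_lt]
      omega
    simp only [Finset.mem_filter, Finset.mem_univ, true_and, not_lt] at ht'
    rw [hnth (d (a r) + 1) (by omega)] at h3
    have h5 := hanti (show (⟨d (a r) + 1, by omega⟩ : Fin n) ≤ t from ht')
    have h6 := hT t ht
    omega
  obtain ⟨hres, hext⟩ := residual_realizable d (a r) S hvS hS htop hf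
  have hval : ∀ i < r, residualDegree d (a r) S (a i) = d (a i) - 1 := by
    intro i hi
    rw [residualDegree, if_neg (fun h : a i = a r => hvS (h ▸ hmemS i hi)), if_pos (hmemS i hi)]
  obtain ⟨H, hH, hHadj⟩ := exists_clique_of_slack (r - 1) (by omega) (residualDegree d (a r) S) a
    (fun i j hi hj => hinj i j (by omega) (by omega))
    (by
      intro i j hij hj
      rw [hval i (by omega), hval j (by omega)]
      exact Nat.sub_le_sub_right (hmono i j hij (by omega)) 1)
    (by
      intro x hx
      rw [hval _ (by omega), residualDegree]
      split_ifs with hxr hxS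
      · exact Nat.zero_le _
      · refine Nat.sub_le_sub_right (hout₀ x fun h => ?_) 1
        obtain ⟨i, hi, rfl⟩ := (hmem₀ x).1 h
        exact hx i (by omega) rfl
      · have := hstrict x hxS hxr
        omega)
    (by
      rw [hval _ (by omega)]
      omega)
    (by
      have h5 : r - 1 - 2 = r - 3 := by omega
      rw [h5, hval _ (by omega)]
      omega)
    (by
      intro i hi
      have h5 := h4 (i + 1) (by omega) (by omega)
      rw [hda i (by omega)] at h5
      rw [hval i (by omega)]
      omega)
    hres
  obtain ⟨G, hG, hle, hGS⟩ := hext H hH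
  have hadj : ∀ i j, i < j → j ≤ r → G.Adj (a i) (a j) := by
    intro i j hij hj
    rcases hj.eq_or_lt with rfl | hlt'
    · exact (hGS _ (hmemS i hij)).symm
    · exact hle (hHadj i j hij (by omega))
  refine ⟨G, fun i => by rw [← deg_eq_degree, hG], fun i j hi hj hij => ?_⟩
  have hi' : a i = i := Fin.ext (ha i (by omega))
  have hj' : a j = j := Fin.ext (ha j (by omega))
  rw [← hi', ← hj']
  rcases lt_or_gt_of_ne (Fin.val_ne_of_ne hij) with h | h
  · exact hadj i j h (by omega)
  · exact (hadj j i h (by omega)).symm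
end

section
/- Let r ≥ 4 and n ≥ 2r+2 be integers, and let π = (d_1, d_2, ..., d_n) be an n-term graphic sequence with d_{r−2} ≥ r−1 and d_{r+1} ≥ r−2, and with σ(π) ≥ (r−1)(2n−r) − 3(n−r) − 1 if n−r is odd, and σ(π) ≥ (r−1)(2n−r) − 3(n−r) − 2 if n−r is even. If d_i ≥ 2r−i for every i = 1, 2, ..., r−3, then π is potentially K_{r+1} − Z_4-graphic. -/
open SimpleGraph Finset
open scoped Classical

namespace SubRealization

variable {n : ℕ}

/-- Degree of `v` in `Q`. -/
noncomputable def dg (Q : SimpleGraph (Fin n)) (v : Fin n) : ℕ := #{u | Q.Adj v u}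

/-- Number of neighbours of `w` inside `U`. -/
noncomputable def en (Q : SimpleGraph (Fin n)) (w : Fin n) (U : Finset (Fin n)) : ℕ :=
  #{u ∈ U | Q.Adj w u}

/-- The graph `Q` with the edge `ab` added. -/
def addE (Q : SimpleGraph (Fin n)) (a b : Fin n) : SimpleGraph (Fin n) where
  Adj u v := Q.Adj u v ∨ a ≠ b ∧ (u = a ∧ v = b ∨ u = b ∧ v = a)
  symm := ⟨by intro u v h; rcases h with h | ⟨h, h'⟩
              · exact Or.inl h.symm
              · exact Or.inr ⟨h, by tauto⟩⟩
  loopless := ⟨by intro u h; rcases h with h | ⟨h, h'⟩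
                  · exact Q.loopless.irrefl u h
                  · rcases h' with ⟨rfl, hab⟩ | ⟨rfl, hab⟩
                    · exact h hab
                    · exact h hab.symm⟩

/-- The graph `Q` with the edge `ab` deleted. -/
def delE (Q : SimpleGraph (Fin n)) (a b : Fin n) : SimpleGraph (Fin n) where
  Adj u v := Q.Adj u v ∧ ¬ (u = a ∧ v = b ∨ u = b ∧ v = a)
  symm := ⟨fun u v h => ⟨h.1.symm, by tauto⟩⟩
  loopless := ⟨fun u h => Q.loopless.irrefl u h.1⟩

theorem addE_adj {Q : SimpleGraph (Fin n)} {a b u v : Fin n} :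
    (addE Q a b).Adj u v ↔ Q.Adj u v ∨ a ≠ b ∧ (u = a ∧ v = b ∨ u = b ∧ v = a) := Iff.rfl

theorem delE_adj {Q : SimpleGraph (Fin n)} {a b u v : Fin n} :
    (delE Q a b).Adj u v ↔ Q.Adj u v ∧ ¬ (u = a ∧ v = b ∨ u = b ∧ v = a) := Iff.rfl

theorem dg_addE {Q : SimpleGraph (Fin n)} {a b : Fin n} (hab : a ≠ b) (h : ¬ Q.Adj a b)
    (v : Fin n) :
    dg (addE Q a b) v = dg Q v + (if v = a then 1 else 0) + (if v = b then 1 else 0) := by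
  have h' : ¬ Q.Adj b a := fun k => h k.symm
  unfold dg
  by_cases hva : v = a
  · subst hva
    have : ({u | (addE Q v b).Adj v u} : Finset (Fin n)) =
        insert b ({u | Q.Adj v u} : Finset (Fin n)) := by
      ext u; simp [addE_adj, hab]; tauto
    rw [this, card_insert_of_notMem (by simpa using h)]
    simp [hab]
  · by_cases hvb : v = b
    · subst hvb
      have : ({u | (addE Q a v).Adj v u} : Finset (Fin n)) =
          insert a ({u | Q.Adj v u} : Finset (Fin n)) := by
        ext u; simp [addE_adj, hab, hva]; tauto
      rw [this, card_insert_of_notMem (by simpa using h')]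
      simp [hva]
    · simp [addE_adj, hva, hvb]

theorem dg_delE {Q : SimpleGraph (Fin n)} {a b : Fin n} (h : Q.Adj a b) (v : Fin n) :
    dg (delE Q a b) v + (if v = a then 1 else 0) + (if v = b then 1 else 0) = dg Q v := by
  have hab : a ≠ b := h.ne
  have h1 : addE (delE Q a b) a b = Q := by
    ext u w
    simp only [addE_adj, delE_adj]
    constructor
    · rintro (k | ⟨_, ⟨rfl, rfl⟩ | ⟨rfl, rfl⟩⟩)
      exacts [k.1, h, h.symm]
    · intro k; tauto
  have h2 := dg_addE (Q := delE Q a b) hab (by simp [delE_adj]) v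
  rw [h1] at h2
  exact h2.symm

theorem dg_eq_degree (Q : SimpleGraph (Fin n)) (v : Fin n) : dg Q v = Q.degree v := by
  unfold dg
  rw [← SimpleGraph.card_neighborFinset_eq_degree]
  congr 1
  ext u; simp

theorem sum_dg_eq (Q : SimpleGraph (Fin n)) (U : Finset (Fin n)) :
    ∑ v ∈ U, dg Q v = ∑ w, en Q w U := by
  unfold dg en
  simp only [card_filter]
  rw [sum_comm]
  simp only [Q.adj_comm]

theorem even_sum_dg (Q : SimpleGraph (Fin n)) : Even (∑ v, dg Q v) := by
  simp only [dg_eq_degree]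
  rw [Q.sum_degrees_eq_twice_card_edges]
  exact even_two_mul _

theorem en_le_card (Q : SimpleGraph (Fin n)) (w : Fin n) (U : Finset (Fin n)) :
    en Q w U ≤ #U := card_filter_le _ _

theorem en_le_dg (Q : SimpleGraph (Fin n)) (w : Fin n) (U : Finset (Fin n)) :
    en Q w U ≤ dg Q w := by
  unfold en dg
  exact card_le_card (fun u hu => by simp at hu ⊢; exact hu.2)

theorem en_lt_card {Q : SimpleGraph (Fin n)} {w v : Fin n} {U : Finset (Fin n)} (hv : v ∈ U)
    (h : ¬ Q.Adj w v) : en Q w U < #U := by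
  unfold en
  apply card_lt_card
  refine ⟨filter_subset _ _, fun k => h ?_⟩
  have := k hv
  simp at this; exact this.2

theorem en_eq_card {Q : SimpleGraph (Fin n)} {w : Fin n} {U : Finset (Fin n)}
    (h : ∀ v ∈ U, Q.Adj w v) : en Q w U = #U := by
  unfold en
  rw [filter_true_of_mem h]

theorem en_eq_dg {Q : SimpleGraph (Fin n)} {w : Fin n} {U : Finset (Fin n)}
    (h : ∀ v, Q.Adj w v → v ∈ U) : en Q w U = dg Q w := by
  unfold en dg
  congr 1; ext u; simp; exact h u

theorem en_add_en (Q : SimpleGraph (Fin n)) (w : Fin n) {U W : Finset (Fin n)}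
    (h : Disjoint U W) : en Q w U + en Q w W = en Q w (U ∪ W) := by
  unfold en
  rw [filter_union, card_union_of_disjoint (disjoint_filter_filter h)]

/-- Obstruction of Erdős–Gallai type: a clique `U` that meets every other vertex as often as
possible cannot contain a deficient vertex. -/
theorem false_of_saturated {G Q : SimpleGraph (Fin n)} {d : Fin n → ℕ} (hG : ∀ v, dg G v = d v)
    {U : Finset (Fin n)} (hU : ∀ a ∈ U, ∀ b ∈ U, a ≠ b → Q.Adj a b)
    (hout : ∀ l, l ∉ U → min (d l) #U ≤ en Q l U) (hle : ∀ v, dg Q v ≤ d v)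
    {x : Fin n} (hx : x ∈ U) (hlt : dg Q x < d x) : False := by
  have h1 : ∑ v ∈ U, dg Q v < ∑ v ∈ U, d v := sum_lt_sum (fun v _ => hle v) ⟨x, hx, hlt⟩
  have h2 : ∑ v ∈ U, d v = ∑ w, en G w U := by
    rw [← sum_dg_eq]; simp [hG]
  rw [h2, sum_dg_eq] at h1
  refine absurd (sum_le_sum fun w _ => ?_) h1.not_ge
  by_cases hw : w ∈ U
  · have e1 := en_lt_card hw (G.loopless.irrefl w)
    have e2 : #(U.erase w) ≤ en Q w U := by
      unfold en
      refine card_le_card fun u hu => ?_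
      rw [mem_erase] at hu
      simp [hu.2, hU w hw u hu.2 hu.1.symm]
    rw [card_erase_of_mem hw] at e2
    omega
  · have := hout w hw
    have e1 := en_le_card G w U
    have e2 := en_le_dg G w U
    rw [hG] at e2
    omega

theorem exists_nbr {Q : SimpleGraph (Fin n)} {x c : Fin n} (h : dg Q x < dg Q c) :
    ∃ u, Q.Adj c u ∧ ¬ Q.Adj x u ∧ u ≠ x := by
  by_contra! hc
  by_cases hx : Q.Adj c x
  · have : ({u | Q.Adj c u} : Finset (Fin n)) ⊆
        insert x (({u | Q.Adj x u} : Finset (Fin n)).erase c) := by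
      intro u hu
      simp at hu ⊢
      have h1 := hc u hu
      have := hu.ne'
      tauto
    have := card_le_card this
    have h2 := card_insert_le x (({u | Q.Adj x u} : Finset (Fin n)).erase c)
    rw [card_erase_of_mem (by simpa using hx.symm)] at h2
    have h3 : 0 < #({u | Q.Adj x u} : Finset (Fin n)) := card_pos.2 ⟨c, by simpa using hx.symm⟩
    unfold dg at h; omega
  · have : ({u | Q.Adj c u} : Finset (Fin n)) ⊆ ({u | Q.Adj x u} : Finset (Fin n)) := by
      intro u hu
      simp at hu ⊢
      have h1 := hc u hu
      by_contra k
      exact hx (h1 k ▸ hu)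
    have := card_le_card this
    unfold dg at h; omega

theorem exists_nbr_ne {Q : SimpleGraph (Fin n)} {x c : Fin n} (h : dg Q x + 1 < dg Q c)
    (w : Fin n) : ∃ u, Q.Adj c u ∧ ¬ Q.Adj x u ∧ u ≠ x ∧ u ≠ w := by
  by_cases hcw : Q.Adj c w
  · have key := dg_delE hcw
    have h0 := key c
    have h1 := key x
    have hne := hcw.ne
    have hlt : dg (delE Q c w) x < dg (delE Q c w) c := by
      simp only [if_true, if_neg hne] at h0
      omega
    obtain ⟨u, k1, k2, k3⟩ := exists_nbr hlt
    rw [delE_adj] at k1 k2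
    have huw : u ≠ w := by rintro rfl; simp at k1
    refine ⟨u, k1.1, fun k => k2 ⟨k, ?_⟩, k3, huw⟩
    rintro (⟨_, q⟩ | ⟨_, q⟩)
    · exact huw q
    · exact k1.1.ne q.symm
  · obtain ⟨u, k1, k2, k3⟩ := exists_nbr (Q := Q) (x := x) (c := c) (by omega)
    exact ⟨u, k1, k2, k3, by rintro rfl; exact hcw k1⟩

/-- `Q` contains `F`, its degrees lie between `lo` and `d`, the vertices below `x` have their full
degree, and the only edges beyond `x` are those of `F`. -/
structure Sub (F : SimpleGraph (Fin n)) (lo d : Fin n → ℕ) (x : ℕ) (Q : SimpleGraph (Fin n)) :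
    Prop where
  le : ∀ a b, F.Adj a b → Q.Adj a b
  le_d : ∀ v, dg Q v ≤ d v
  sat : ∀ v : Fin n, v.val < x → dg Q v = d v
  indep : ∀ a b : Fin n, x < a.val → x < b.val → Q.Adj a b → F.Adj a b
  lo_le : ∀ v, lo v ≤ dg Q v

/-- `Q` has the largest possible degree at `x` among all subrealizations for `x`, and yet `x`
is deficient. -/
structure Stuck (F : SimpleGraph (Fin n)) (lo d : Fin n → ℕ) (x : Fin n)
    (Q : SimpleGraph (Fin n)) : Prop extends Sub F lo d x.val Q where
  lt : dg Q x < d x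
  max : ∀ Q', Sub F lo d x.val Q' → dg Q' x ≤ dg Q x

variable {F Q G : SimpleGraph (Fin n)} {lo d : Fin n → ℕ} {x : Fin n}

theorem Sub.mono {F' : SimpleGraph (Fin n)} {lo' : Fin n → ℕ} {x x' : ℕ} (h : Sub F lo d x Q)
    (hF : ∀ a b, F'.Adj a b → Q.Adj a b)
    (hindep : ∀ a b : Fin n, x' < a.val → x' < b.val → Q.Adj a b → F'.Adj a b)
    (hlo : ∀ v, lo' v ≤ dg Q v) (hx : x' ≤ x) :
    Sub F' lo' d x' Q :=
  ⟨hF, h.le_d, fun v hv => h.sat v (by omega), hindep, hlo⟩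

/-- If no graph is stuck at `x`, then `x` can be given its full degree. -/
theorem Sub.saturate (x : Fin n) (h : Sub F lo d x.val Q) (hno : ∀ Q, ¬ Stuck F lo d x Q) :
    ∃ Q, Sub F lo d x.val Q ∧ dg Q x = d x := by
  obtain ⟨Q', hQ', hmax⟩ :=
    (Set.toFinite {Q | Sub F lo d x.val Q}).exists_maximalFor (fun Q => dg Q x) _ ⟨Q, h⟩
  refine ⟨Q', hQ', ?_⟩
  by_contra hne
  have hle := hQ'.le_d x
  refine hno Q' ⟨hQ', by omega, fun Q'' h'' => ?_⟩
  by_contra hlt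
  exact hlt (hmax h'' (by simp only; omega))

theorem Sub.succ (h : Sub F lo d x.val Q) (hx : dg Q x = d x) : Sub F lo d (x.val + 1) Q := by
  refine ⟨h.le, h.le_d, fun v hv => ?_, fun a b ha hb => h.indep a b (by omega) (by omega), h.lo_le⟩
  rcases Nat.lt_succ_iff_lt_or_eq.1 hv with hv | hv
  · exact h.sat v hv
  · rwa [Fin.ext hv]

/-- Iterating `Sub.saturate` over an interval of vertices. -/
theorem Sub.steps {s t : ℕ} (hst : s ≤ t) (ht : t ≤ n) (h : ∃ Q, Sub F lo d s Q)
    (hno : ∀ x : Fin n, s ≤ x.val → x.val < t → ∀ Q, ¬ Stuck F lo d x Q) :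
    ∃ Q, Sub F lo d t Q := by
  induction t, hst using Nat.le_induction with
  | base => exact h
  | succ t hst ih =>
    obtain ⟨Q, hQ⟩ := ih (by omega) (fun x h1 h2 => hno x h1 (by omega))
    obtain ⟨Q', hQ', hx⟩ := hQ.saturate ⟨t, by omega⟩ (hno ⟨t, by omega⟩ hst (by simp))
    exact ⟨Q', hQ'.succ hx⟩

theorem Stuck.false_of_gain (h : Stuck F lo d x Q) (Q' : SimpleGraph (Fin n))
    (hF : ∀ a b, F.Adj a b → Q'.Adj a b)
    (hind : ∀ a b : Fin n, x < a → x < b → Q'.Adj a b → F.Adj a b)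
    (hT : ∀ v < x, dg Q' v = dg Q v) (hL : ∀ v, x < v → dg Q' v ≤ d v)
    (hlo : ∀ v, x < v → lo v ≤ dg Q' v) (hx : dg Q' x = dg Q x + 1) : False := by
  have hlt := h.lt
  have : Sub F lo d x.val Q' := by
    refine ⟨hF, fun v => ?_, fun v hv => ?_, hind, fun v => ?_⟩
    · rcases lt_trichotomy v x with k | rfl | k
      · rw [hT v k]; exact h.le_d v
      · omega
      · exact hL v k
    · rw [hT v hv]; exact h.sat v hv
    · rcases lt_trichotomy v x with k | rfl | k
      · rw [hT v k]; exact h.lo_le v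
      · have := h.lo_le v; omega
      · exact hlo v k
  have := h.max _ this
  omega

theorem Stuck.adj_of_deficient (h : Stuck F lo d x Q) {l : Fin n} (hl : x < l)
    (hd : dg Q l < d l) : Q.Adj x l := by
  by_contra hn
  have key := dg_addE hl.ne hn
  refine h.false_of_gain (addE Q x l) (fun a b k => Or.inl (h.le a b k)) ?_ ?_ ?_ ?_ ?_
  · intro a b ha hb hab
    rw [addE_adj] at hab
    have := h.indep a b ha hb
    grind
  · intro v hv; rw [key]; grind
  · intro v hv; rw [key]; have := h.le_d v; grind
  · intro v hv; rw [key]; have := h.lo_le v; grind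
  · rw [key]; grind

/-- If the total deficiency is not concentrated on `x`, some later vertex is deficient. -/
theorem Stuck.exists_deficient (h : Stuck F lo d x Q) (hG : ∀ v, dg G v = d v)
    (h1 : d x = dg Q x + 1) : ∃ y, x < y ∧ dg Q y < d y := by
  by_contra! hc
  have heq : ∀ v, v ≠ x → dg Q v = d v := by
    intro v hv
    rcases lt_or_gt_of_ne hv with k | k
    · exact h.sat v k
    · exact le_antisymm (h.le_d v) (hc v k)
  have e1 := even_sum_dg Q
  have e2 := even_sum_dg G
  simp only [hG] at e2
  rw [← add_sum_erase _ _ (mem_univ x)] at e1 e2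
  rw [sum_congr rfl (fun v hv => heq v (ne_of_mem_erase hv))] at e1
  rw [h1] at e2
  grind

/-- No modification gains two at a stuck vertex while keeping its neighbours. -/
theorem Stuck.false_of_gain_two (h : Stuck F 0 d x Q) (hG : ∀ v, dg G v = d v)
    (Q' : SimpleGraph (Fin n)) (hF : ∀ a b, F.Adj a b → Q'.Adj a b)
    (hind : ∀ a b : Fin n, x < a → x < b → Q'.Adj a b → F.Adj a b)
    (hT : ∀ v < x, dg Q' v = dg Q v) (hL : ∀ v, x < v → dg Q' v ≤ dg Q v)
    (hx : dg Q' x = dg Q x + 2) (hkeep : ∀ w, Q.Adj x w → Q'.Adj x w)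
    (hFx : ∀ w, ¬ F.Adj x w) : False := by
  by_cases hdef : d x = dg Q x + 1
  · obtain ⟨y, hy, hyd⟩ := h.exists_deficient hG hdef
    have hxy := hkeep y (h.adj_of_deficient hy hyd)
    have key := dg_delE hxy
    have hFx' : ∀ w, ¬ F.Adj w x := fun w k => hFx w k.symm
    refine h.false_of_gain (delE Q' x y) ?_ ?_ ?_ ?_ ?_ ?_
    · intro a b k
      rw [delE_adj]
      have := hF a b k
      have := hFx b
      have := hFx' a
      grind
    · intro a b ha hb hab
      exact hind a b ha hb hab.1
    · intro v hv; have := key v; have := hT v hv; grind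
    · intro v hv; have := key v; have := hL v hv; have := h.le_d v; omega
    · intro v hv; simp
    · have := key x; grind
  · have hlt := h.lt
    have : Sub F 0 d x.val Q' := by
      refine ⟨hF, fun v => ?_, fun v hv => ?_, hind, fun v => by simp⟩
      · rcases lt_trichotomy v x with k | rfl | k
        · rw [hT v k]; exact h.le_d v
        · omega
        · exact (hL v k).trans (h.le_d v)
      · rw [hT v hv]; exact h.sat v hv
    have := h.max _ this
    omega

theorem Stuck.false_of_shift (h : Stuck F 0 d x Q) {v l : Fin n} (hv : v < x) (hl : x < l)
    (hvl : Q.Adj v l) (hF : ¬ F.Adj v l) (hvx : ¬ Q.Adj v x) : False := by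
  have hF' : ¬ F.Adj l v := fun k => hF k.symm
  have k1 := dg_delE hvl
  have k2 := dg_addE (Q := delE Q v l) hv.ne (by rw [delE_adj]; tauto)
  refine h.false_of_gain (addE (delE Q v l) v x) ?_ ?_ ?_ ?_ ?_ ?_
  · intro a b k
    have := h.le a b k
    simp only [addE_adj, delE_adj]; grind
  · intro a b ha hb hab
    have := h.indep a b ha hb
    simp only [addE_adj, delE_adj] at hab
    grind
  · intro w hw; have := k1 w; have := k2 w; grind
  · intro w hw; have := k1 w; have := k2 w; have := h.le_d w; grind
  · simp
  · have := k1 x; have := k2 x; grind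

theorem Stuck.false_of_swap (h : Stuck F lo d x Q) {u v y : Fin n} (hv : v < x) (hy : x < y)
    (hyd : dg Q y < d y) (huv : Q.Adj u v) (hF : ¬ F.Adj u v) (hux : ¬ Q.Adj x u) (hux' : u ≠ x)
    (hvy : ¬ Q.Adj v y) : False := by
  have hF' : ¬ F.Adj v u := fun k => hF k.symm
  have hux'' : ¬ Q.Adj u x := fun k => hux k.symm
  have hne : u ≠ y := by rintro rfl; exact hvy huv.symm
  have k1 := dg_delE huv
  have k2 := dg_addE (Q := delE Q u v) hux' (by rw [delE_adj]; tauto)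
  have k3 := dg_addE (Q := addE (delE Q u v) u x) (hv.trans hy).ne
    (by simp only [addE_adj, delE_adj]; grind)
  refine h.false_of_gain (addE (addE (delE Q u v) u x) v y) ?_ ?_ ?_ ?_ ?_ ?_
  · intro a b k
    have := h.le a b k
    simp only [addE_adj, delE_adj]; grind
  · intro a b ha hb hab
    have := h.indep a b ha hb
    simp only [addE_adj, delE_adj] at hab
    grind
  · intro w hw; have := k1 w; have := k2 w; have := k3 w; grind
  · intro w hw; have := k1 w; have := k2 w; have := k3 w; have := h.le_d w; grind
  · intro w hw; have := k1 w; have := k2 w; have := k3 w; have := h.lo_le w; grind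
  · have := k1 x; have := k2 x; have := k3 x; grind

theorem Stuck.false_of_subdivide (h : Stuck F 0 d x Q) (hG : ∀ v, dg G v = d v)
    (hFx : ∀ w, ¬ F.Adj x w) {u c : Fin n} (huc : Q.Adj u c) (hF : ¬ F.Adj u c)
    (hux : ¬ Q.Adj x u) (hux' : u ≠ x) (hcx : ¬ Q.Adj x c) (hcx' : c ≠ x) : False := by
  have hF' : ¬ F.Adj c u := fun k => hF k.symm
  have a1 : ¬ Q.Adj u x := fun k => hux k.symm
  have a2 : ¬ Q.Adj c x := fun k => hcx k.symm
  have hne := huc.ne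
  have k1 := dg_delE huc
  have k2 := dg_addE (Q := delE Q u c) hux' (by rw [delE_adj]; tauto)
  have k3 := dg_addE (Q := addE (delE Q u c) u x) hcx'
    (by simp only [addE_adj, delE_adj]; grind)
  refine h.false_of_gain_two hG (addE (addE (delE Q u c) u x) c x) ?_ ?_ ?_ ?_ ?_ ?_ hFx
  · intro a b k
    have := h.le a b k
    simp only [addE_adj, delE_adj]; grind
  · intro a b ha hb hab
    have := h.indep a b ha hb
    simp only [addE_adj, delE_adj] at hab
    grind
  · intro w hw; have := k1 w; have := k2 w; have := k3 w; grind
  · intro w hw; have := k1 w; have := k2 w; have := k3 w; grind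
  · have := k1 x; have := k2 x; have := k3 x; grind
  · intro w hw; simp only [addE_adj, delE_adj]; grind

/-- Here `u = l` is allowed. -/
theorem Stuck.false_of_exchange (h : Stuck F 0 d x Q) {u c v l : Fin n} (hc : c < x) (hv : v < x)
    (hl : x < l) (hcv : c ≠ v) (huc : Q.Adj u c) (hFuc : ¬ F.Adj u c) (hvl : Q.Adj v l)
    (hFvl : ¬ F.Adj v l) (hux : ¬ Q.Adj x u) (hux' : u ≠ x) (hcv' : ¬ Q.Adj v c) : False := by
  have b1 : ¬ F.Adj c u := fun k => hFuc k.symm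
  have b2 : ¬ F.Adj l v := fun k => hFvl k.symm
  have a1 : ¬ Q.Adj u x := fun k => hux k.symm
  have a2 : ¬ Q.Adj c v := fun k => hcv' k.symm
  have hne := huc.ne
  have hne2 : u ≠ v := by rintro rfl; exact hcv' huc
  have k1 := dg_delE huc
  have k2 := dg_delE (Q := delE Q u c) (a := v) (b := l) (by rw [delE_adj]; grind)
  have k3 := dg_addE (Q := delE (delE Q u c) v l) hcv.symm
    (by simp only [delE_adj]; grind)
  have k4 := dg_addE (Q := addE (delE (delE Q u c) v l) v c) hux'
    (by simp only [addE_adj, delE_adj]; grind)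
  refine h.false_of_gain (addE (addE (delE (delE Q u c) v l) v c) u x) ?_ ?_ ?_ ?_ ?_ ?_
  · intro a b k
    have := h.le a b k
    simp only [addE_adj, delE_adj]; grind
  · intro a b ha hb hab
    have := h.indep a b ha hb
    simp only [addE_adj, delE_adj] at hab
    grind
  · intro w hw; have := k1 w; have := k2 w; have := k3 w; have := k4 w; grind
  · intro w hw; have := k1 w; have := k2 w; have := k3 w; have := k4 w; have := h.le_d w; grind
  · simp
  · have := k1 x; have := k2 x; have := k3 x; have := k4 x; grind

theorem Stuck.false_of_exchange_two (h : Stuck F 0 d x Q) (hG : ∀ v, dg G v = d v)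
    (hFx : ∀ w, ¬ F.Adj x w) {u c w c' : Fin n} (hc : c < x) (hc' : c' < x) (huw : u ≠ w)
    (hcc : c ≠ c') (hcc' : ¬ Q.Adj c c') (huc : Q.Adj u c) (hFuc : ¬ F.Adj u c)
    (hwc : Q.Adj w c') (hFwc : ¬ F.Adj w c') (hux : ¬ Q.Adj x u) (hux' : u ≠ x)
    (hwx : ¬ Q.Adj x w) (hwx' : w ≠ x) : False := by
  have b1 : ¬ F.Adj c u := fun k => hFuc k.symm
  have b2 : ¬ F.Adj c' w := fun k => hFwc k.symm
  have a1 : ¬ Q.Adj u x := fun k => hux k.symm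
  have a2 : ¬ Q.Adj w x := fun k => hwx k.symm
  have a3 : ¬ Q.Adj c' c := fun k => hcc' k.symm
  have n1 := huc.ne
  have n2 := hwc.ne
  have n3 : u ≠ c' := by rintro rfl; exact a3 huc
  have n4 : w ≠ c := by rintro rfl; exact hcc' hwc
  have k1 := dg_delE huc
  have k2 := dg_delE (Q := delE Q u c) (a := w) (b := c') (by rw [delE_adj]; grind)
  have k3 := dg_addE (Q := delE (delE Q u c) w c') hcc (by simp only [delE_adj]; grind)
  have k4 := dg_addE (Q := addE (delE (delE Q u c) w c') c c') hux'
    (by simp only [addE_adj, delE_adj]; grind)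
  have k5 := dg_addE (Q := addE (addE (delE (delE Q u c) w c') c c') u x) hwx'
    (by simp only [addE_adj, delE_adj]; grind)
  refine h.false_of_gain_two hG
    (addE (addE (addE (delE (delE Q u c) w c') c c') u x) w x) ?_ ?_ ?_ ?_ ?_ ?_ hFx
  · intro a b k
    have := h.le a b k
    simp only [addE_adj, delE_adj]; grind
  · intro a b ha hb hab
    have := h.indep a b ha hb
    simp only [addE_adj, delE_adj] at hab
    grind
  · intro z hz; have := k1 z; have := k2 z; have := k3 z; have := k4 z; have := k5 z; grind
  · intro z hz; have := k1 z; have := k2 z; have := k3 z; have := k4 z; have := k5 z; grind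
  · have := k1 x; have := k2 x; have := k3 x; have := k4 x; have := k5 x; grind
  · intro z hz; simp only [addE_adj, delE_adj]; grind

theorem Stuck.false_of_exchange_common (h : Stuck F 0 d x Q) {u c c' y : Fin n} (hc : c < x)
    (hc' : c' < x) (hu : u < x) (hy : x < y) (hyd : dg Q y < d y)
    (hcc : c ≠ c') (hcc' : ¬ Q.Adj c c') (huc : Q.Adj u c) (hFuc : ¬ F.Adj u c)
    (huc' : Q.Adj u c') (hFuc' : ¬ F.Adj u c') (hux : ¬ Q.Adj x u) (huy : ¬ Q.Adj u y) :
    False := by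
  have b1 : ¬ F.Adj c u := fun k => hFuc k.symm
  have b2 : ¬ F.Adj c' u := fun k => hFuc' k.symm
  have a1 : ¬ Q.Adj u x := fun k => hux k.symm
  have a2 : ¬ Q.Adj y u := fun k => huy k.symm
  have a3 : ¬ Q.Adj c' c := fun k => hcc' k.symm
  have n1 := huc.ne
  have n2 := huc'.ne
  have k1 := dg_delE huc
  have k2 := dg_delE (Q := delE Q u c) (a := u) (b := c') (by rw [delE_adj]; grind)
  have k3 := dg_addE (Q := delE (delE Q u c) u c') hcc (by simp only [delE_adj]; grind)
  have k4 := dg_addE (Q := addE (delE (delE Q u c) u c') c c') hu.ne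
    (by simp only [addE_adj, delE_adj]; grind)
  have k5 := dg_addE (Q := addE (addE (delE (delE Q u c) u c') c c') u x) (hu.trans hy).ne
    (by simp only [addE_adj, delE_adj]; grind)
  refine h.false_of_gain
    (addE (addE (addE (delE (delE Q u c) u c') c c') u x) u y) ?_ ?_ ?_ ?_ ?_ ?_
  · intro a b k
    have := h.le a b k
    simp only [addE_adj, delE_adj]; grind
  · intro a b ha hb hab
    have := h.indep a b ha hb
    simp only [addE_adj, delE_adj] at hab
    grind
  · intro z hz; have := k1 z; have := k2 z; have := k3 z; have := k4 z; have := k5 z; grind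
  · intro z hz; have := k1 z; have := k2 z; have := k3 z; have := k4 z; have := k5 z
    have := h.le_d z; grind
  · simp
  · have := k1 x; have := k2 x; have := k3 x; have := k4 x; have := k5 x; grind

theorem dg_eq_en_add (Q : SimpleGraph (Fin n)) (v : Fin n) (S : Finset (Fin n)) :
    dg Q v = en Q v S + en Q v Sᶜ := by
  rw [en_add_en _ _ disjoint_compl_right, en_eq_dg (by simp)]

/-- Vertices `≤ x` forming a clique cannot get stuck at `x` while `x` sees almost all of a set `S`
that supports `F`. -/
theorem Stuck.false_of_clique (h : Stuck F lo d x Q) (hG : ∀ v, dg G v = d v) (hd : Antitone d)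
    {S : Finset (Fin n)} (hS : ∀ v ≤ x, v ∈ S) (hFS : ∀ a b, F.Adj a b → a ∈ S)
    (hclique : ∀ a ≤ x, ∀ b ≤ x, a ≠ b → Q.Adj a b) (hcount : #S ≤ en Q x S + 2)
    (hL : ∀ l ∈ S, x < l → (∀ v ≤ x, Q.Adj l v) ∨ ∀ w, F.Adj l w → w ≤ x) : False := by
  have hdef : ∀ y, x < y → dg Q y < d y → ∀ v ≤ x, Q.Adj y v := by
    intro y hy hyd v hv
    have hxy := h.adj_of_deficient hy hyd
    rcases hv.lt_or_eq with hv | rfl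
    swap
    · exact hxy.symm
    by_contra hvy
    have hvy' : ¬ Q.Adj v y := fun k => hvy k.symm
    obtain ⟨u, hu1, hu2, hu3⟩ : ∃ u, Q.Adj v u ∧ ¬ Q.Adj x u ∧ u ∉ S := by
      by_contra! hc
      have hsub : insert v (insert y ({u | Q.Adj v u} : Finset (Fin n))) ⊆
          S ∪ ({u ∈ Sᶜ | Q.Adj x u} : Finset (Fin n)) := by
        intro u hu
        simp only [mem_insert, mem_filter, mem_univ, true_and] at hu
        simp only [mem_union, mem_filter, mem_compl]
        rcases hu with rfl | rfl | hu
        · exact Or.inl (hS _ hv.le)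
        · tauto
        · have := hc u hu; tauto
      have hcard := card_le_card hsub
      rw [card_insert_of_notMem, card_insert_of_notMem (by simpa using hvy')] at hcard
      swap
      · simp [(hv.trans hy).ne]
      have h1 := card_union_le S ({u ∈ Sᶜ | Q.Adj x u} : Finset (Fin n))
      have h2 := dg_eq_en_add Q x S
      have h3 := h.sat v hv
      have h4 := hd hv.le
      have h5 := h.lt
      unfold en at *
      unfold dg at *
      omega
    refine h.false_of_swap hv hy hyd hu1.symm (fun k => hu3 (hFS _ _ k)) hu2 ?_ hvy'
    rintro rfl; exact hu3 (hS _ le_rfl)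
  refine false_of_saturated hG (Q := Q) (U := ({v | v ≤ x} : Finset (Fin n))) (x := x) ?_ ?_ h.le_d
    (by simp) h.lt
  · intro a ha b hb
    simp only [mem_filter, mem_univ, true_and] at ha hb
    exact hclique a ha b hb
  · intro l hl
    simp only [mem_filter, mem_univ, true_and, not_le] at hl
    by_cases hall : ∀ v ≤ x, Q.Adj l v
    · rw [en_eq_card (by simpa using hall)]; exact min_le_right _ _
    · have hsat : d l ≤ dg Q l := not_lt.1 fun k => hall (hdef l hl k)
      rw [en_eq_dg]
      · exact (min_le_left _ _).trans hsat
      · intro v hv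
        simp only [mem_filter, mem_univ, true_and]
        by_contra hvx
        have hF := h.indep l v hl (not_le.1 hvx) hv
        rcases hL l (hFS _ _ hF) hl with k | k
        · exact hall k
        · exact hvx (k v hF)

/-- The common setting of the final phase: `F` lives on the vertices of value at most `r`, and the
construction is stuck at a vertex `x` beyond them. -/
structure Tail (r : ℕ) (F : SimpleGraph (Fin n)) (d : Fin n → ℕ) (x : Fin n)
    (Q G : SimpleGraph (Fin n)) : Prop extends Stuck F 0 d x Q where
  real : ∀ v, dg G v = d v
  anti : Antitone d
  supp : ∀ a b, F.Adj a b → a.val ≤ r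
  gt : r < x.val

variable {r : ℕ}

theorem Tail.not_F (h : Tail r F d x Q G) {a b : Fin n} (ha : r < a.val) : ¬ F.Adj a b :=
  fun k => absurd (h.supp a b k) (by omega)

theorem Tail.not_F' (h : Tail r F d x Q G) {a b : Fin n} (ha : r < a.val) : ¬ F.Adj b a :=
  fun k => h.not_F ha k.symm

theorem Tail.dg_lt (h : Tail r F d x Q G) {c : Fin n} (hc : c < x) : dg Q x < dg Q c := by
  have := h.lt
  have := h.sat c hc
  have := h.anti hc.le
  omega

theorem Tail.lt_val (h : Tail r F d x Q G) {l : Fin n} (hl : x < l) : r < l.val :=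
  h.gt.trans hl

theorem Tail.lt_x (h : Tail r F d x Q G) {v : Fin n} (hv : v.val ≤ r) : v < x :=
  Fin.lt_def.2 (lt_of_le_of_lt hv h.gt)

theorem Tail.not_adj_later (h : Tail r F d x Q G) {v l : Fin n} (hv : v < x) (hvx : ¬ Q.Adj v x)
    (hl : x < l) : ¬ Q.Adj v l :=
  fun k => h.false_of_shift hv hl k (h.not_F' (h.lt_val hl)) hvx

theorem Tail.adj_x (h : Tail r F d x Q G) {c : Fin n} (hc : r < c.val) (hcx : c < x) :
    Q.Adj c x := by
  by_contra hn
  obtain ⟨u, h1, h2, h3⟩ := exists_nbr (h.dg_lt hcx)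
  exact h.false_of_subdivide h.real (fun _ => h.not_F h.gt) h1.symm (h.not_F' hc) h2 h3
    (fun k => hn k.symm) hcx.ne

theorem Tail.adj_of_later (h : Tail r F d x Q G) {v l c : Fin n} (hv : v < x) (hl : x < l)
    (hvl : Q.Adj v l) (hc : r < c.val) (hcx : c < x) (hne : c ≠ v) : Q.Adj v c := by
  by_contra hn
  obtain ⟨u, h1, h2, h3⟩ := exists_nbr (h.dg_lt hcx)
  exact h.false_of_exchange hcx hv hl hne h1.symm (h.not_F' hc) hvl
    (h.not_F' (h.lt_val hl)) h2 h3 hn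

theorem Tail.clique (h : Tail r F d x Q G) {c c' : Fin n} (hc : r < c.val) (hc' : r < c'.val)
    (hcx : c < x) (hcx' : c' < x) (hne : c ≠ c') : Q.Adj c c' := by
  by_contra hn
  have noL : ∀ l, x < l → ¬ Q.Adj c l := fun l hl k =>
    hn (h.adj_of_later hcx hl k hc' hcx' hne.symm)
  have noL' : ∀ l, x < l → ¬ Q.Adj c' l := fun l hl k =>
    hn (h.adj_of_later hcx' hl k hc hcx hne).symm
  obtain ⟨w, w1, w2, w3⟩ := exists_nbr (h.dg_lt hcx')
  have hex : ∀ u, Q.Adj c u → ¬ Q.Adj x u → u ≠ x → u = w := by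
    intro u h1 h2 h3
    by_contra huw
    exact h.false_of_exchange_two h.real (fun _ => h.not_F h.gt) hcx hcx' huw hne hn h1.symm
      (h.not_F' hc) w1.symm (h.not_F' hc') h2 h3 w2 w3
  by_cases hdef : d x = dg Q x + 1
  · obtain ⟨u, h1, h2, h3⟩ := exists_nbr (h.dg_lt hcx)
    obtain rfl := hex u h1 h2 h3
    obtain ⟨y, hy, hyd⟩ := h.exists_deficient h.real hdef
    have hux : u < x := lt_of_le_of_ne (not_lt.1 fun k => noL u k h1) h3
    exact h.false_of_exchange_common hcx hcx' hux hy hyd hne hn h1.symm (h.not_F' hc) w1.symm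
      (h.not_F' hc') h2 (h.not_adj_later hux (fun k => h2 k.symm) hy)
  · have h0 := h.lt
    have h1 := h.sat c hcx
    have h2 := h.anti hcx.le
    obtain ⟨u, k1, k2, k3, k4⟩ := exists_nbr_ne (Q := Q) (x := x) (c := c) (by omega) w
    exact k4 (hex u k1 k2 k3)

theorem Tail.not_adj_later_of_miss (h : Tail r F d x Q G) {v c l : Fin n} (hv : v.val ≤ r)
    (hc : r < c.val) (hcx : c ≤ x) (hvc : ¬ Q.Adj v c) (hl : x < l) : ¬ Q.Adj v l := by
  have hvx : v < x := h.lt_x hv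
  rcases hcx.lt_or_eq with k | rfl
  · intro hvl
    exact hvc (h.adj_of_later hvx hl hvl hc k (by rintro rfl; omega))
  · exact h.not_adj_later hvx hvc hl

theorem Tail.exists_miss (h : Tail r F d x Q G) :
    ∃ v c : Fin n, v.val ≤ r ∧ r < c.val ∧ c ≤ x ∧ ¬ Q.Adj v c := by
  by_contra! hc
  have later : ∀ b : Fin n, b.val ≤ r → ∃ u, Q.Adj b u ∧ ¬ Q.Adj x u ∧ x < u := by
    intro b hb
    obtain ⟨u, h1, h2, h3⟩ := exists_nbr (h.dg_lt (c := b) (h.lt_x hb))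
    refine ⟨u, h1, h2, ?_⟩
    by_contra hu
    have hux := lt_of_le_of_ne (not_lt.1 hu) h3
    by_cases hur : u.val ≤ r
    · exact h2 (hc u x hur h.gt le_rfl).symm
    · exact h2 (h.adj_x (by omega) hux).symm
  have hS : ∀ b b' : Fin n, b.val ≤ r → b'.val ≤ r → b ≠ b' → Q.Adj b b' := by
    intro b b' hb hb' hne
    by_contra hn
    obtain ⟨u, u1, u2, u3⟩ := later b hb
    obtain ⟨w, w1, w2, w3⟩ := later b' hb'
    exact h.false_of_exchange (h.lt_x hb) (h.lt_x hb') w3 hne u1.symm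
      (h.not_F (h.lt_val u3)) w1 (h.not_F' (h.lt_val w3)) u2 u3.ne' (fun k => hn k.symm)
  have hall : ∀ a ≤ x, ∀ b ≤ x, a ≠ b → Q.Adj a b := by
    intro a ha b hb hne
    by_cases har : a.val ≤ r <;> by_cases hbr : b.val ≤ r
    · exact hS a b har hbr hne
    · exact hc a b har (by omega) hb
    · exact (hc b a hbr (by omega) ha).symm
    · rcases ha.lt_or_eq with ha | rfl
      · rcases hb.lt_or_eq with hb | rfl
        · exact h.clique (by omega) (by omega) ha hb hne
        · exact h.adj_x (by omega) ha
      · exact (h.adj_x (by omega) (lt_of_le_of_ne hb hne.symm)).symm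
  refine h.false_of_clique h.real h.anti (S := ({v | v ≤ x} : Finset (Fin n))) (by simp) ?_
    hall ?_ ?_
  · intro a b k
    have := h.supp a b k
    have := h.gt
    simp only [mem_filter, mem_univ, true_and]
    exact Fin.le_def.2 (by omega)
  · have : #(({v | v ≤ x} : Finset (Fin n)).erase x) ≤ en Q x ({v | v ≤ x} : Finset (Fin n)) := by
      unfold en
      refine card_le_card fun u hu => ?_
      simp only [mem_erase, mem_filter, mem_univ, true_and] at hu ⊢
      exact ⟨hu.2, hall x le_rfl u hu.2 hu.1.symm⟩
    rw [card_erase_of_mem (by simp)] at this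
    omega
  · intro l hl hxl
    simp only [mem_filter, mem_univ, true_and] at hl
    exact absurd hxl hl.not_gt

theorem card_val_Icc {a b : ℕ} (hb : b < n) :
    #({v | a ≤ v.val ∧ v.val ≤ b} : Finset (Fin n)) = b + 1 - a := by
  rw [← Nat.card_Icc, ← card_map Fin.valEmbedding]
  congr 1
  ext i
  simp only [mem_map, mem_filter, mem_univ, true_and, Fin.valEmbedding_apply, mem_Icc]
  constructor
  · rintro ⟨v, hv, rfl⟩; exact hv
  · intro hi; exact ⟨⟨i, by omega⟩, hi, rfl⟩

/-- The vertices of the head. -/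
def headSet (n r : ℕ) : Finset (Fin n) := {v | v.val ≤ r}

/-- The vertices strictly beyond the head, up to `x`. -/
def midSet (r : ℕ) (x : Fin n) : Finset (Fin n) := {v | r < v.val ∧ v ≤ x}

/-- The vertices beyond `x`. -/
def lateSet (x : Fin n) : Finset (Fin n) := {v | x < v}

/-- The head vertices missing some vertex of `midSet r x`. -/
noncomputable def missSet (Q : SimpleGraph (Fin n)) (r : ℕ) (x : Fin n) : Finset (Fin n) :=
  {v | v.val ≤ r ∧ ∃ c : Fin n, r < c.val ∧ c ≤ x ∧ ¬ Q.Adj v c}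

theorem mem_headSet {v : Fin n} : v ∈ headSet n r ↔ v.val ≤ r := by simp [headSet]

theorem mem_midSet {v : Fin n} : v ∈ midSet r x ↔ r < v.val ∧ v ≤ x := by simp [midSet]

theorem mem_lateSet {v : Fin n} : v ∈ lateSet x ↔ x < v := by simp [lateSet]

theorem mem_missSet {v : Fin n} :
    v ∈ missSet Q r x ↔ v.val ≤ r ∧ ∃ c : Fin n, r < c.val ∧ c ≤ x ∧ ¬ Q.Adj v c := by
  simp [missSet]

theorem missSet_subset : missSet Q r x ⊆ headSet n r := fun v hv => by
  rw [mem_missSet] at hv; rw [mem_headSet]; exact hv.1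

theorem card_headSet (hr : r < n) : #(headSet n r) = r + 1 := by
  have := card_val_Icc (n := n) (a := 0) hr
  simpa [headSet] using this

theorem card_midSet : #(midSet r x) = x.val - r := by
  have := card_val_Icc (n := n) (a := r + 1) x.isLt
  rw [show x.val - r = x.val + 1 - (r + 1) by omega, ← this]
  congr 1

theorem head_union_mid_union_late :
    (headSet n r ∪ midSet r x) ∪ lateSet x = univ := by
  ext v
  simp only [mem_union, mem_headSet, mem_midSet, mem_lateSet, mem_univ, iff_true, Fin.le_def,
    Fin.lt_def]
  omega

theorem disjoint_head_mid : Disjoint (headSet n r) (midSet r x) := by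
  rw [Finset.disjoint_left]; intro v; rw [mem_headSet, mem_midSet]; omega

theorem disjoint_head_mid_late (hx : r < x.val) :
    Disjoint (headSet n r ∪ midSet r x) (lateSet x) := by
  rw [Finset.disjoint_left]; intro v
  rw [mem_union, mem_headSet, mem_midSet, mem_lateSet, Fin.le_def, Fin.lt_def]; omega

theorem sum_split (hx : r < x.val) (f : Fin n → ℕ) :
    ∑ v, f v = ∑ v ∈ headSet n r, f v + ∑ v ∈ midSet r x, f v + ∑ v ∈ lateSet x, f v := by
  rw [← head_union_mid_union_late, sum_union (disjoint_head_mid_late hx),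
    sum_union disjoint_head_mid]

theorem dg_split (hx : r < x.val) (v : Fin n) :
    dg Q v = en Q v (headSet n r) + en Q v (midSet r x) + en Q v (lateSet x) := by
  rw [en_add_en _ _ disjoint_head_mid, en_add_en _ _ (disjoint_head_mid_late hx),
    head_union_mid_union_late]
  exact (en_eq_dg (by simp)).symm

theorem en_add_card_le {v : Fin n} {U W : Finset (Fin n)} (hW : W ⊆ U)
    (h : ∀ w ∈ W, ¬ Q.Adj v w) : en Q v U + #W ≤ #U := by
  unfold en
  rw [← card_union_of_disjoint]
  · exact card_le_card (union_subset (filter_subset _ _) hW)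
  · rw [Finset.disjoint_left]
    intro u hu hw
    exact h u hw (mem_filter.1 hu).2

theorem en_clique {v : Fin n} {U : Finset (Fin n)} (hv : v ∈ U)
    (h : ∀ u ∈ U, u ≠ v → Q.Adj v u) : en Q v U = #U - 1 := by
  rw [← card_erase_of_mem hv]
  unfold en
  congr 1
  ext u
  simp only [mem_filter, mem_erase]
  constructor
  · rintro ⟨h1, h2⟩; exact ⟨h2.ne', h1⟩
  · rintro ⟨h1, h2⟩; exact ⟨h2, h u h2 h1⟩

theorem Tail.adj_mid (h : Tail r F d x Q G) {a b : Fin n} (ha : a ∈ midSet r x)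
    (hb : b ∈ midSet r x) (hne : a ≠ b) : Q.Adj a b := by
  rw [mem_midSet] at ha hb
  rcases ha.2.lt_or_eq with hax | rfl
  · rcases hb.2.lt_or_eq with hbx | rfl
    · exact h.clique ha.1 hb.1 hax hbx hne
    · exact h.adj_x ha.1 hax
  · exact (h.adj_x hb.1 (lt_of_le_of_ne hb.2 hne.symm)).symm

theorem Tail.mem_mid (h : Tail r F d x Q G) : x ∈ midSet r x := mem_midSet.2 ⟨h.gt, le_rfl⟩

theorem Tail.en_mid (h : Tail r F d x Q G) {c : Fin n} (hc : c ∈ midSet r x) :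
    en Q c (midSet r x) = x.val - r - 1 := by
  rw [← card_midSet]
  exact en_clique hc fun u hu hne => h.adj_mid hc hu hne.symm

theorem Tail.two_le (h : Tail r F d x Q G) : dg Q x + 2 ≤ d x + en Q x (lateSet x) := by
  have hlt := h.lt
  by_cases hdef : d x = dg Q x + 1
  · obtain ⟨y, hy, hyd⟩ := h.exists_deficient h.real hdef
    have : 0 < en Q x (lateSet x) := by
      unfold en
      exact card_pos.2 ⟨y, by simp [mem_lateSet, hy, h.adj_of_deficient hy hyd]⟩
    omega
  · omega

theorem Tail.miss_split (h : Tail r F d x Q G) {v : Fin n} (hv : v ∈ missSet Q r x) :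
    d v = en Q v (headSet n r) + en Q v (midSet r x) := by
  rw [mem_missSet] at hv
  obtain ⟨hv, c, h1, h2, h3⟩ := hv
  have : en Q v (lateSet x) = 0 := by
    unfold en
    rw [card_eq_zero, filter_eq_empty_iff]
    intro l hl
    exact h.not_adj_later_of_miss hv h1 h2 h3 (mem_lateSet.1 hl)
  rw [← h.sat v (h.lt_x hv), dg_split h.gt, this, add_zero]

theorem Tail.r_lt (h : Tail r F d x Q G) : r < n := h.gt.trans x.isLt

theorem Tail.en_head_le (h : Tail r F d x Q G) {v : Fin n} (hv : v.val ≤ r) :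
    en Q v (headSet n r) ≤ r := by
  have := en_lt_card (mem_headSet.2 hv) (Q.loopless.irrefl v)
  rw [card_headSet h.r_lt] at this
  omega

theorem Tail.en_mid_miss (_ : Tail r F d x Q G) {v : Fin n} (hv : v ∈ missSet Q r x) :
    en Q v (midSet r x) + 1 ≤ x.val - r := by
  obtain ⟨hv, c, h1, h2, h3⟩ := mem_missSet.1 hv
  rw [← card_midSet]
  exact en_lt_card (mem_midSet.2 ⟨h1, h2⟩) h3

theorem Tail.d_miss_le (h : Tail r F d x Q G) {v : Fin n} (hv : v ∈ missSet Q r x) :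
    d v + 1 ≤ x.val := by
  have h1 := h.miss_split hv
  have h2 := h.en_head_le (mem_missSet.1 hv).1
  have h3 := h.en_mid_miss hv
  have := h.gt
  omega

/-- Vertex `x` sees every head vertex outside `missSet Q r x`. -/
theorem Tail.en_x_head (h : Tail r F d x Q G) :
    en Q x (headSet n r) + #(missSet Q r x) = r + 1 + en Q x (missSet Q r x) := by
  have h1 : en Q x (headSet n r \ missSet Q r x) = #(headSet n r \ missSet Q r x) := by
    refine en_eq_card fun v hv => ?_
    rw [mem_sdiff, mem_headSet, mem_missSet] at hv
    by_contra hn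
    exact hv.2 ⟨hv.1, x, h.gt, le_rfl, fun k => hn k.symm⟩
  have h2 := en_add_en Q x (disjoint_sdiff (s := missSet Q r x) (t := headSet n r))
  rw [union_sdiff_of_subset missSet_subset, h1, card_sdiff_of_subset missSet_subset,
    card_headSet h.r_lt] at h2
  have h3 := card_le_card (missSet_subset (Q := Q) (r := r) (x := x))
  rw [card_headSet h.r_lt] at h3
  omega

theorem Tail.miss_bound (h : Tail r F d x Q G) :
    x.val + 2 + en Q x (missSet Q r x) ≤ d x + #(missSet Q r x) := by
  have h1 := h.en_x_head
  have h2 := h.two_le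
  have h3 := h.en_mid h.mem_mid
  have h4 := dg_split (Q := Q) h.gt x
  have := h.gt
  omega

/-- Double counting of the edges that meet `midSet r x`. -/
theorem Tail.sum_bound (h : Tail r F d x Q G) :
    (x.val - r) * (x.val - r - 1) + (r + 1 - #(missSet Q r x)) * (x.val - r) +
      ∑ v ∈ missSet Q r x, en Q v (midSet r x) + 2 ≤ ∑ v ∈ midSet r x, d v := by
  have h1 := sum_dg_eq Q (midSet r x)
  rw [sum_split h.gt] at h1
  have h2 : ∑ v ∈ midSet r x, en Q v (midSet r x) = (x.val - r) * (x.val - r - 1) := by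
    rw [sum_congr rfl fun v hv => h.en_mid hv, sum_const, card_midSet, smul_eq_mul]
  have h3 : ∑ v ∈ headSet n r, en Q v (midSet r x) =
      (r + 1 - #(missSet Q r x)) * (x.val - r) + ∑ v ∈ missSet Q r x, en Q v (midSet r x) := by
    rw [← sum_sdiff (missSet_subset (Q := Q) (r := r) (x := x))]
    congr 1
    rw [← card_headSet h.r_lt, ← card_sdiff_of_subset missSet_subset, ← smul_eq_mul, ← sum_const]
    refine sum_congr rfl fun v hv => ?_
    rw [← card_midSet]
    refine en_eq_card fun c hc => ?_
    rw [mem_sdiff, mem_headSet, mem_missSet] at hv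
    rw [mem_midSet] at hc
    by_contra hn
    exact hv.2 ⟨hv.1, c, hc.1, hc.2, hn⟩
  have h4 : en Q x (lateSet x) ≤ ∑ v ∈ lateSet x, en Q v (midSet r x) := by
    unfold en
    rw [card_filter]
    refine sum_le_sum fun v _ => ?_
    split_ifs with hv
    · exact card_pos.2 ⟨x, by simp [h.mem_mid, hv.symm]⟩
    · omega
  have h5 : ∑ v ∈ midSet r x, dg Q v + (d x - dg Q x) ≤ ∑ v ∈ midSet r x, d v := by
    rw [← add_sum_erase _ _ h.mem_mid, ← add_sum_erase _ d h.mem_mid]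
    have := sum_le_sum (s := (midSet r x).erase x) (fun v _ => h.le_d v)
    have := h.lt
    omega
  have h6 := h.two_le
  have := h.lt
  omega

/-- The final phase never gets stuck. -/
theorem Tail.false (h : Tail r F d x Q G) (hr : 4 ≤ r)
    (hA : ∀ v : Fin n, v.val < r - 3 → 2 * r - 1 ≤ d v + v.val)
    (hP : ∀ v : Fin n, v.val = r → r - 1 ≤ d v → ∀ a b, F.Adj a b → r - 3 ≤ a.val →
      r - 3 ≤ b.val → a.val ≠ r ∧ b.val ≠ r ∧ (a.val = r - 3 ∨ b.val = r - 3)) : False := by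
  obtain ⟨t, ht⟩ : ∃ t, x.val = r + t := ⟨x.val - r, by have := h.gt; omega⟩
  have htpos : 1 ≤ t := by have := h.gt; omega
  have hrn := h.r_lt
  set bl : Fin n := ⟨r, hrn⟩ with hbl
  obtain ⟨v₀, c₀, hv₀⟩ := h.exists_miss
  have hv₀ : v₀ ∈ missSet Q r x := mem_missSet.2 ⟨hv₀.1, c₀, hv₀.2⟩
  have hm : ∀ v : Fin n, v.val ≤ r → d bl ≤ d v := fun v hv => h.anti (Fin.le_def.2 hv)
  have hm' : ∀ v : Fin n, r < v.val → d v ≤ d bl := fun v hv => h.anti (Fin.le_def.2 hv.le)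
  have hq : d bl + 1 ≤ r + t := by
    have := h.d_miss_le hv₀
    have := hm v₀ (mem_missSet.1 hv₀).1
    omega
  have hindex : ∀ v ∈ missSet Q r x, r ≤ v.val + max t 3 := by
    intro v hv
    by_contra hlt
    have := h.d_miss_le hv
    have := hA v (by omega)
    omega
  have hbound := h.miss_bound
  have hdx := hm' x h.gt
  rcases le_or_gt t 3 with ht3 | ht4
  · have hJ : missSet Q r x ⊆ ({v | r - 3 ≤ v.val ∧ v.val ≤ r} : Finset (Fin n)) := by
      intro v hv
      have h1 := (mem_missSet.1 hv).1
      have h2 := hindex v hv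
      simp only [mem_filter, mem_univ, true_and]
      omega
    have hJ4 := card_val_Icc (n := n) (a := r - 3) hrn
    set M : Finset (Fin n) := {v ∈ missSet Q r x | ¬ Q.Adj x v} with hM
    have hMcard : #M + en Q x (missSet Q r x) = #(missSet Q r x) := by
      unfold en
      rw [add_comm, hM]
      exact card_filter_add_card_filter_not (s := missSet Q r x) (fun v => Q.Adj x v)
    have hMsub : M ⊆ ({v | r - 3 ≤ v.val ∧ v.val ≤ r} : Finset (Fin n)) :=
      (filter_subset _ _).trans hJ
    have hMle := card_le_card hMsub
    have hP' := hP bl rfl (by omega)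
    have nadj : ∀ a ∈ M, ∀ b ∈ M, Q.Adj a b → F.Adj a b := by
      intro a ha b hb hab
      by_contra hF
      rw [hM, mem_filter] at ha hb
      have ha' := (mem_missSet.1 ha.1).1
      have hb' := (mem_missSet.1 hb.1).1
      exact h.false_of_subdivide h.real (fun _ => h.not_F h.gt) hab hF ha.2 (h.lt_x ha').ne hb.2
        (h.lt_x hb').ne
    have hdeg : ∀ a ∈ M, r + t ≤ en Q a (headSet n r) + (t - 1) + (r + t - d bl) := by
      intro a ha
      have ha := (mem_filter.1 ha).1
      have h1 := h.miss_split ha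
      have h2 := h.en_mid_miss ha
      have h3 := hm a (mem_missSet.1 ha).1
      omega
    have hhead : ∀ a ∈ M, a ∈ headSet n r := fun a ha => missSet_subset (mem_filter.1 ha).1
    have hS := card_headSet hrn
    have hB : ∀ a ∈ M, r - 3 ≤ a.val ∧ a.val ≤ r := fun a ha => by
      have := hMsub ha
      simpa using this
    have hlast : ∀ b ∈ M, bl ∈ M → ¬ Q.Adj bl b := by
      intro b hb hbl' hadj
      have h1 := (hB b hb).1
      exact (hP' _ _ (nadj bl hbl' b hb hadj) (by simp [hbl]) h1).1 rfl
    rcases (show d bl + 1 = r + t ∨ d bl + 2 = r + t by omega) with hq1 | hq2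
    · have hadj : ∀ a ∈ M, ∀ b ∈ M, a ≠ b → Q.Adj a b := by
        intro a ha b hb hne
        by_contra hn
        have h1 := en_add_card_le (Q := Q) (v := a) (U := headSet n r) (W := {a, b})
          (by simp [insert_subset_iff, hhead a ha, hhead b hb])
          (by simp [hn])
        rw [card_pair hne] at h1
        have := hdeg a ha
        omega
      by_cases hblM : bl ∈ M
      · obtain ⟨b, hb, hne⟩ := exists_mem_ne (s := M) (by omega) bl
        exact hlast b hb hblM (hadj bl hblM b hb hne.symm)
      · have hsub : M ⊆ ({v | r - 3 ≤ v.val ∧ v.val ≤ r - 1} : Finset (Fin n)) := by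
          intro v hv
          have h1 := hB v hv
          have h2 : v ≠ bl := by rintro rfl; exact hblM hv
          have h3 : v.val ≠ r := fun k => h2 (Fin.ext k)
          simp only [mem_filter, mem_univ, true_and]
          omega
        have hcard := card_val_Icc (n := n) (a := r - 3) (b := r - 1) (by omega)
        have heq := eq_of_subset_of_card_le hsub (by omega)
        have m2 : (⟨r - 2, by omega⟩ : Fin n) ∈ M := by rw [heq]; simp; omega
        have m3 : (⟨r - 1, by omega⟩ : Fin n) ∈ M := by rw [heq]; simp; omega
        have hne : (⟨r - 2, by omega⟩ : Fin n) ≠ ⟨r - 1, by omega⟩ := by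
          rw [Ne, Fin.mk.injEq]; omega
        have := (hP' _ _ (nadj _ m2 _ m3 (hadj _ m2 _ m3 hne)) (by simp; omega)
          (by simp; omega)).2.2
        simp only at this
        omega
    · have heq := eq_of_subset_of_card_le hMsub (by omega)
      have m1 : (⟨r - 3, by omega⟩ : Fin n) ∈ M := by rw [heq]; simp; omega
      have m2 : (⟨r - 2, by omega⟩ : Fin n) ∈ M := by rw [heq]; simp; omega
      have m4 : bl ∈ M := by rw [heq]; simp [hbl]
      have h1 := en_add_card_le (Q := Q) (v := bl) (U := headSet n r)
        (W := {bl, ⟨r - 3, by omega⟩, ⟨r - 2, by omega⟩})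
        (by simp [insert_subset_iff, hhead _ m1, hhead _ m2, hhead _ m4])
        (by simp [hlast _ m1 m4, hlast _ m2 m4])
      have h2 : #({bl, ⟨r - 3, by omega⟩, ⟨r - 2, by omega⟩} : Finset (Fin n)) = 3 :=
        card_eq_three.2 ⟨_, _, _, by rw [hbl, Ne, Fin.mk.injEq]; omega,
          by rw [hbl, Ne, Fin.mk.injEq]; omega, by rw [Ne, Fin.mk.injEq]; omega, rfl⟩
      have := hdeg bl m4
      omega
  · have hsub : missSet Q r x ⊆ ({v | r - t ≤ v.val ∧ v.val ≤ r} : Finset (Fin n)) := by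
      intro v hv
      have h1 := (mem_missSet.1 hv).1
      have h2 := hindex v hv
      simp only [mem_filter, mem_univ, true_and]
      omega
    have hcardB := card_val_Icc (n := n) (a := r - t) hrn
    have hR := card_le_card hsub
    have hR' := card_le_card (missSet_subset (Q := Q) (r := r) (x := x))
    rw [card_headSet hrn] at hR'
    have hsum := h.sum_bound
    have hsum' : ∑ v ∈ midSet r x, d v ≤ t * d bl := by
      rw [show t = #(midSet r x) by rw [card_midSet]; omega, ← smul_eq_mul]
      exact sum_le_card_nsmul _ _ _ fun v hv => hm' v (mem_midSet.1 hv).1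
    have hJ : ∀ v ∈ missSet Q r x, (d v : ℤ) - r ≤ (en Q v (midSet r x) : ℤ) := by
      intro v hv
      have h1 := h.miss_split hv
      have h2 := h.en_head_le (mem_missSet.1 hv).1
      omega
    have hJsum := sum_le_sum hJ
    rw [show x.val - r = t by omega] at hsum
    set R := #(missSet Q r x) with hRdef
    have hsumZ : (t : ℤ) * (t - 1) + (r + 1 - R) * t +
        ∑ v ∈ missSet Q r x, (en Q v (midSet r x) : ℤ) + 2 ≤ t * d bl := by
      have := hsum.trans hsum'
      zify [htpos, hR'] at this
      exact this
    rcases (show R ≤ t ∨ R = t + 1 by omega) with hRt | hRt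
    · have h1 : (R : ℤ) * (d bl - r) ≤ ∑ v ∈ missSet Q r x, ((d v : ℤ) - r) := by
        rw [hRdef, ← nsmul_eq_mul]
        refine card_nsmul_le_sum _ _ _ fun v hv => ?_
        have := hm v (mem_missSet.1 hv).1
        omega
      zify at hRt hq
      nlinarith [mul_nonneg (sub_nonneg.2 hRt) (show (0 : ℤ) ≤ r + t - 1 - d bl by linarith)]
    · have heq := eq_of_subset_of_card_le hsub (by omega)
      have hmem : (⟨r - t, by omega⟩ : Fin n) ∈ missSet Q r x := by
        rw [heq]; simp only [mem_filter, mem_univ, true_and]; omega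
      have hd0 := hA ⟨r - t, by omega⟩ (by simp only; omega)
      simp only at hd0
      have h1 : ((t : ℤ)) * (d bl - r) + (t - 1) ≤ ∑ v ∈ missSet Q r x, ((d v : ℤ) - r) := by
        rw [← add_sum_erase _ _ hmem]
        have h2 : (#((missSet Q r x).erase ⟨r - t, by omega⟩) : ℤ) * (d bl - r) ≤
            ∑ v ∈ (missSet Q r x).erase ⟨r - t, by omega⟩, ((d v : ℤ) - r) := by
          rw [← nsmul_eq_mul]
          refine card_nsmul_le_sum _ _ _ fun v hv => ?_
          have := hm v (mem_missSet.1 (mem_of_mem_erase hv)).1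
          omega
        rw [card_erase_of_mem hmem, ← hRdef, hRt, Nat.add_sub_cancel] at h2
        have h3 : (t : ℤ) - 1 ≤ (d ⟨r - t, by omega⟩ : ℤ) - r := by omega
        linarith
      have hRt' : (R : ℤ) = t + 1 := by exact_mod_cast hRt
      rw [hRt'] at hsumZ
      nlinarith

/-- Completing a head realization to a realization of the whole sequence. -/
theorem exists_realization_of_head {r : ℕ} (hr : 4 ≤ r) (hn : r + 1 ≤ n)
    (hG : ∀ v, dg G v = d v) (hd : Antitone d) (h : Sub F lo d (r + 1) Q)
    (hF : ∀ a b, F.Adj a b → a.val ≤ r)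
    (hA : ∀ v : Fin n, v.val < r - 3 → 2 * r - 1 ≤ d v + v.val)
    (hP : ∀ v : Fin n, v.val = r → r - 1 ≤ d v → ∀ a b, F.Adj a b → r - 3 ≤ a.val →
      r - 3 ≤ b.val → a.val ≠ r ∧ b.val ≠ r ∧ (a.val = r - 3 ∨ b.val = r - 3)) :
    ∃ Q', (∀ v, dg Q' v = d v) ∧ ∀ a b, F.Adj a b → Q'.Adj a b := by
  obtain ⟨Q', hQ'⟩ := Sub.steps (F := F) (lo := 0) (d := d) hn le_rfl
    ⟨Q, h.mono h.le h.indep (by simp) le_rfl⟩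
    (fun x hx _ Q hQ => Tail.false (⟨hQ, hG, hd, hF, hx⟩ : Tail r F d x Q G) hr hA hP)
  exact ⟨Q', fun v => hQ'.sat v v.isLt, hQ'.le⟩

theorem KsubH_Z4_adj {r : ℕ} (h : 4 ≤ r + 1) {u v : Fin (r + 1)}
    (huv : (KsubH (r + 1) 4 h Z4).Adj u v) (hlt : u < v) (hv : v.val < 4) :
    u.val = 0 ∧ v.val = 1 ∨ u.val = 1 ∧ v.val = 2 := by
  have hu : u.val < 4 := lt_trans hlt hv
  have hne : u ≠ v := hlt.ne
  simp only [KsubH, SimpleGraph.sdiff_adj, SimpleGraph.map_adj, not_exists, not_and] at huv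
  by_contra hc
  have hlt' : u.val < v.val := hlt
  refine huv.2 ⟨u.val, hu⟩ ⟨v.val, hv⟩ ?_ (by ext; simp) (by ext; simp)
  generalize u.val = i at *
  generalize v.val = j at *
  simp only [Z4, SimpleGraph.sdiff_adj, SimpleGraph.top_adj, SimpleGraph.fromEdgeSet_adj]
  interval_cases j <;> interval_cases i <;> simp_all

theorem containsCopy_of_parts {r : ℕ} (hr : 4 ≤ r) (G : SimpleGraph (Fin n))
    (A : Finset (Fin n)) (hA : #A = r - 3) (p₀ p₁ p₂ p₃ : Fin n)
    (hp : p₀ ∉ A ∧ p₁ ∉ A ∧ p₂ ∉ A ∧ p₃ ∉ A)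
    (hdist : p₀ ≠ p₁ ∧ p₀ ≠ p₂ ∧ p₀ ≠ p₃ ∧ p₁ ≠ p₂ ∧ p₁ ≠ p₃ ∧ p₂ ≠ p₃)
    (hclique : ∀ a ∈ A, ∀ b ∈ A, a ≠ b → G.Adj a b)
    (hadj : ∀ a ∈ A, G.Adj p₀ a ∧ G.Adj p₁ a ∧ G.Adj p₂ a ∧ G.Adj p₃ a)
    (h₁ : G.Adj p₀ p₁) (h₂ : G.Adj p₁ p₂) :
    ContainsCopy G (KsubH (r + 1) 4 (by omega) Z4) := by
  set g : Fin (r - 3) ↪o Fin n := A.orderEmbOfFin hA with hg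
  have gmem : ∀ i, g i ∈ A := fun i => A.orderEmbOfFin_mem hA i
  set f : Fin (r + 1) → Fin n := fun i =>
    if h : 4 ≤ i.val then g ⟨i.val - 4, by omega⟩
    else if i.val = 0 then p₀ else if i.val = 1 then p₁ else if i.val = 2 then p₂ else p₃ with hf
  have fbig : ∀ i : Fin (r + 1), ∀ h : 4 ≤ i.val, f i = g ⟨i.val - 4, by omega⟩ := by
    intro i h; simp [hf, h]
  have fsmall : ∀ i : Fin (r + 1), i.val < 4 →
      i.val = 0 ∧ f i = p₀ ∨ i.val = 1 ∧ f i = p₁ ∨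
        i.val = 2 ∧ f i = p₂ ∨ i.val = 3 ∧ f i = p₃ := by
    intro i hi
    have : i.val = 0 ∨ i.val = 1 ∨ i.val = 2 ∨ i.val = 3 := by omega
    have hi' : ¬ 4 ≤ i.val := by omega
    rcases this with k | k | k | k <;> (simp only [hf, dif_neg hi', k]; simp)
  have fmem : ∀ i : Fin (r + 1), 4 ≤ i.val → f i ∈ A := by
    intro i h; rw [fbig i h]; exact gmem _
  have finj : ∀ i j : Fin (r + 1), i < j → f i ≠ f j := by
    intro i j hij
    have hij' : i.val < j.val := hij
    by_cases hj : 4 ≤ j.val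
    · by_cases hi : 4 ≤ i.val
      · rw [fbig i hi, fbig j hj]
        intro k
        have := g.injective k
        rw [Fin.mk.injEq] at this
        omega
      · have h1 := fmem j hj
        rcases fsmall i (by omega) with k | k | k | k <;> (rw [k.2]; intro e; rw [← e] at h1; tauto)
    · rcases fsmall i (by omega) with k | k | k | k <;>
      rcases fsmall j (by omega) with k' | k' | k' | k' <;> omega
  have fadj : ∀ i j : Fin (r + 1), i < j → (KsubH (r + 1) 4 (by omega) Z4).Adj i j →
      G.Adj (f i) (f j) := by
    intro i j hij hK
    by_cases hj : 4 ≤ j.val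
    · have h1 := fmem j hj
      by_cases hi : 4 ≤ i.val
      · exact hclique _ (fmem i hi) _ h1 (finj i j hij)
      · have h2 := hadj _ h1
        rcases fsmall i (by omega) with k | k | k | k <;> (rw [k.2]; tauto)
    · have h1 := KsubH_Z4_adj (by omega) hK hij (by omega)
      rcases fsmall i (by omega) with k | k | k | k <;>
      rcases fsmall j (by omega) with k' | k' | k' | k' <;>
      first
      | omega
      | (rw [k.2, k'.2]; assumption)
  refine ⟨⟨f, fun i j hij => ?_⟩, fun i j hK => ?_⟩
  · rcases lt_trichotomy i j with k | k | k
    · exact absurd hij (finj i j k)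
    · exact k
    · exact absurd hij.symm (finj j i k)
  · rcases lt_trichotomy i j with k | k | k
    · exact fadj i j k hK
    · exact absurd k hK.ne
    · exact (fadj j i k hK.symm).symm

/-- The complete graph on the vertices of value at most `r`, minus the pairs in `P`. -/
def headGraph (n r : ℕ) (P : ℕ → ℕ → Prop) : SimpleGraph (Fin n) where
  Adj a b := a ≠ b ∧ a.val ≤ r ∧ b.val ≤ r ∧ ¬ P a.val b.val ∧ ¬ P b.val a.val
  symm := ⟨fun _ _ h => ⟨h.1.symm, h.2.2.1, h.2.1, h.2.2.2.2, h.2.2.2.1⟩⟩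
  loopless := ⟨fun _ h => h.1 rfl⟩

variable {P : ℕ → ℕ → Prop}

theorem headGraph_adj {a b : Fin n} : (headGraph n r P).Adj a b ↔
    a ≠ b ∧ a.val ≤ r ∧ b.val ≤ r ∧ ¬ P a.val b.val ∧ ¬ P b.val a.val := Iff.rfl

theorem card_le_en_add {v : Fin n} {U W : Finset (Fin n)}
    (h : ∀ u ∈ U, u ∉ W → Q.Adj v u) : #U ≤ en Q v U + #W := by
  unfold en
  refine (card_le_card fun u hu => ?_).trans (card_union_le _ W)
  rw [mem_union, mem_filter]
  by_cases hw : u ∈ W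
  · exact Or.inr hw
  · exact Or.inl ⟨hu, h u hu hw⟩

theorem dg_headGraph_le (hr : r < n) {v : Fin n} {W : Finset (Fin n)}
    (hW : ∀ w ∈ W, w.val ≤ r ∧ (w = v ∨ P v.val w.val ∨ P w.val v.val)) :
    dg (headGraph n r P) v + #W ≤ r + 1 := by
  rw [← card_headSet hr, ← en_eq_dg (U := headSet n r)]
  · refine en_add_card_le (fun w hw => mem_headSet.2 (hW w hw).1) fun w hw k => ?_
    rw [headGraph_adj] at k
    have := (hW w hw).2
    have := k.1
    tauto
  · intro u hu
    exact mem_headSet.2 hu.2.2.1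

theorem dg_headGraph_eq_zero {v : Fin n} (hv : r < v.val) : dg (headGraph n r P) v = 0 := by
  unfold dg
  rw [card_eq_zero, filter_eq_empty_iff]
  intro u _ k
  rw [headGraph_adj] at k
  omega

/-- The graph `F` itself starts the construction. -/
theorem Sub.refl (h : ∀ v, dg F v ≤ d v) : Sub F 0 d 0 F :=
  ⟨fun _ _ k => k, h, fun v hv => absurd hv (by omega), fun _ _ _ _ k => k, by simp⟩

/-- A vertex below which `F` is complete to the head is never stuck. -/
theorem not_stuck_of_complete (hG : ∀ v, dg G v = d v) (hd : Antitone d)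
    (hF : ∀ a b, F.Adj a b → a.val ≤ r) (hx : x.val ≤ r)
    (hcomp : ∀ a b : Fin n, a ≤ x → b.val ≤ r → a ≠ b → F.Adj a b) : ¬ Stuck F lo d x Q := by
  intro h
  have hcount : #(headSet n r) ≤ en Q x (headSet n r) + #({x} : Finset (Fin n)) := by
    refine card_le_en_add fun u hu hux => ?_
    rw [mem_singleton] at hux
    exact h.le _ _ (hcomp x u le_rfl (mem_headSet.1 hu) (fun k => hux k.symm))
  rw [card_singleton] at hcount
  refine h.false_of_clique hG hd (S := headSet n r) (fun v hv => mem_headSet.2 ?_)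
    (fun a b k => mem_headSet.2 (hF a b k)) ?_ (by omega) ?_
  · exact (Fin.le_def.1 hv).trans hx
  · intro a ha b hb hne
    exact h.le _ _ (hcomp a b ha ((Fin.le_def.1 hb).trans hx) hne)
  · intro l hl hxl
    refine Or.inl fun v hv => (h.le _ _ (hcomp v l hv (mem_headSet.1 hl) ?_)).symm
    exact (lt_of_le_of_lt hv hxl).ne

/-- The pairs missing from `K_{r+1} - Z₄`, placed on the last four head vertices. -/
def corePairs (r i j : ℕ) : Prop :=
  i + 2 = r ∧ j + 1 = r ∨ i + 3 = r ∧ j = r ∨ i + 2 = r ∧ j = r ∨ i + 1 = r ∧ j = r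

theorem not_corePairs {i j : ℕ} (hi : i + 3 < r) : ¬ corePairs r i j ∧ ¬ corePairs r j i := by
  unfold corePairs; omega

/-- The standing assumptions on the degree sequence. -/
structure Hyp (r : ℕ) (d : Fin n → ℕ) (G : SimpleGraph (Fin n)) : Prop where
  four_le : 4 ≤ r
  lt : r < n
  real : ∀ v, dg G v = d v
  anti : Antitone d
  early : ∀ v : Fin n, v.val < r - 3 → 2 * r - 1 ≤ d v + v.val
  first : ∀ v : Fin n, v.val = r - 3 → r - 1 ≤ d v
  last : ∀ v : Fin n, v.val = r → r - 2 ≤ d v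

theorem Hyp.exists_of_core (H : Hyp r d G) (h : Sub F lo d (r + 1) Q)
    (hF : ∀ a b, F.Adj a b → a.val ≤ r)
    (hcore : ∀ a b, (headGraph n r (corePairs r)).Adj a b → F.Adj a b) :
    ∃ Q, (∀ v, dg Q v = d v) ∧
      ContainsCopy Q (KsubH (r + 1) 4 (by have := H.four_le; omega) Z4) := by
  have hr := H.four_le
  have hrn := H.lt
  have hsub : Sub (headGraph n r (corePairs r)) 0 d (r + 1) Q := by
    refine h.mono (fun a b k => h.le _ _ (hcore a b k)) (fun a b ha hb k => ?_) (by simp) le_rfl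
    have := hF _ _ (h.indep a b ha hb k)
    omega
  obtain ⟨Q', hQ', hle⟩ := exists_realization_of_head hr hrn H.real H.anti hsub
    (fun a b k => k.2.1) H.early (by
      intro v _ _ a b k ha hb
      rw [headGraph_adj] at k
      unfold corePairs at k
      have : a.val ≠ b.val := fun e => k.1 (Fin.ext e)
      omega)
  have hadj : ∀ a b : Fin n, a ≠ b → a.val + 3 < r → b.val ≤ r → Q'.Adj b a :=
    fun a b h1 h2 h3 => (hle _ _ ⟨h1, by omega, h3, not_corePairs h2⟩).symm
  refine ⟨Q', hQ', containsCopy_of_parts hr Q' {v | 0 ≤ v.val ∧ v.val ≤ r - 4} ?_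
    ⟨r - 2, by omega⟩ ⟨r - 3, by omega⟩ ⟨r - 1, by omega⟩ ⟨r, by omega⟩ ?_ ?_ ?_ ?_ ?_ ?_⟩
  · rw [card_val_Icc (by omega)]; omega
  · simp only [mem_filter, mem_univ, true_and]; omega
  · simp only [Ne, Fin.mk.injEq]; omega
  · intro a ha b hb hne
    simp only [mem_filter, mem_univ, true_and] at ha hb
    exact hadj b a hne.symm (by omega) (by omega)
  · intro a ha
    simp only [mem_filter, mem_univ, true_and] at ha
    have key : ∀ b : Fin n, r - 3 ≤ b.val → b.val ≤ r → Q'.Adj b a := fun b h1 h2 =>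
      hadj a b (by rintro rfl; omega) (by omega) h2
    exact ⟨key _ (by simp only; omega) (by simp), key _ (by simp) (by simp),
      key _ (by simp only; omega) (by simp), key _ (by simp) (by simp)⟩
  · refine hle _ _ ⟨by rw [Ne, Fin.mk.injEq]; omega, by simp, by simp, ?_, ?_⟩ <;>
    (simp only [corePairs]; omega)
  · refine hle _ _ ⟨by rw [Ne, Fin.mk.injEq]; omega, by simp, by simp, ?_, ?_⟩ <;>
    (simp only [corePairs]; omega)

theorem Hyp.early_le (H : Hyp r d G) {v : Fin n} (hv : v.val < r - 3) : r + 1 ≤ d v := by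
  have := H.early v hv
  have := H.four_le
  omega

theorem card_triple {i j k : Fin n} (h1 : i.val ≠ j.val) (h2 : i.val ≠ k.val)
    (h3 : j.val ≠ k.val) : #({i, j, k} : Finset (Fin n)) = 3 :=
  card_eq_three.2 ⟨i, j, k, by rintro rfl; exact h1 rfl, by rintro rfl; exact h2 rfl,
    by rintro rfl; exact h3 rfl, rfl⟩

theorem dg_headGraph_le_one (hr : r < n) {v : Fin n} (hv : v.val ≤ r) :
    dg (headGraph n r P) v ≤ r := by
  have := dg_headGraph_le (P := P) hr (v := v) (W := {v}) (by simpa using hv)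
  rw [card_singleton] at this
  omega

theorem dg_headGraph_le_two (hr : r < n) {v a : Fin n} (hv : v.val ≤ r) (ha : a.val ≤ r)
    (hne : v ≠ a) (hP : P v.val a.val ∨ P a.val v.val) : dg (headGraph n r P) v ≤ r - 1 := by
  have := dg_headGraph_le (P := P) hr (v := v) (W := {v, a}) (by simpa [hv, ha] using Or.inr hP)
  rw [card_pair hne] at this
  omega

theorem dg_headGraph_le_three (hr : r < n) {v a b : Fin n} (hv : v.val ≤ r) (ha : a.val ≤ r)
    (hb : b.val ≤ r) (hva : v.val ≠ a.val) (hvb : v.val ≠ b.val) (hab : a.val ≠ b.val)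
    (hPa : P v.val a.val ∨ P a.val v.val) (hPb : P v.val b.val ∨ P b.val v.val) :
    dg (headGraph n r P) v ≤ r - 2 := by
  have := dg_headGraph_le (P := P) hr (v := v) (W := {v, a, b})
    (by simp [hv, ha, hb, hPa, hPb])
  rw [card_triple hva hvb hab] at this
  omega

theorem dg_headGraph_le_of_head (H : Hyp r d G)
    (h : ∀ v : Fin n, r - 3 ≤ v.val → v.val ≤ r → dg (headGraph n r P) v ≤ d v) (v : Fin n) :
    dg (headGraph n r P) v ≤ d v := by
  by_cases hv : r < v.val
  · rw [dg_headGraph_eq_zero hv]; exact Nat.zero_le _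
  · by_cases hv' : v.val < r - 3
    · have h1 := H.early_le hv'
      have h2 := dg_headGraph_le_one (P := P) H.lt (v := v) (by omega)
      omega
    · exact h v (by omega) (by omega)

theorem card_le_dg {v : Fin n} {W : Finset (Fin n)} (h : ∀ w ∈ W, Q.Adj v w) : #W ≤ dg Q v := by
  rw [← en_eq_card h]; exact en_le_dg _ _ _

/-- The missing pairs when the head is as dense as possible. -/
def densePairs (r i j : ℕ) : Prop := (i + 2 = r ∨ i + 1 = r) ∧ j = r

theorem Hyp.exists_of_dense (H : Hyp r d G) (h1 : ∀ v : Fin n, v.val + 3 = r → r ≤ d v)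
    (h3 : ∀ v : Fin n, v.val + 1 = r → r - 1 ≤ d v) :
    ∃ Q, (∀ v, dg Q v = d v) ∧
      ContainsCopy Q (KsubH (r + 1) 4 (by have := H.four_le; omega) Z4) := by
  have hr := H.four_le
  have hrn := H.lt
  obtain ⟨b2, hb2⟩ : ∃ b : Fin n, b.val = r - 2 := ⟨⟨r - 2, by omega⟩, rfl⟩
  obtain ⟨b3, hb3⟩ : ∃ b : Fin n, b.val = r - 1 := ⟨⟨r - 1, by omega⟩, rfl⟩
  obtain ⟨b4, hb4⟩ : ∃ b : Fin n, b.val = r := ⟨⟨r, by omega⟩, rfl⟩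
  have n24 : b2 ≠ b4 := by rintro rfl; omega
  have n34 : b3 ≠ b4 := by rintro rfl; omega
  set F := headGraph n r (densePairs r) with hF
  have hFS : ∀ a b, F.Adj a b → a.val ≤ r := fun a b k => k.2.1
  have hFadj : ∀ a b : Fin n, a ≠ b → a.val < r → b.val < r → F.Adj a b := fun a b k1 k2 k3 => by
    refine ⟨k1, k2.le, k3.le, ?_⟩
    unfold densePairs; omega
  have hFadj' : ∀ a b : Fin n, a ≠ b → a.val + 2 < r → b.val ≤ r → F.Adj a b :=
    fun a b k1 k2 k3 => by
      refine ⟨k1, by omega, k3, ?_⟩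
      unfold densePairs; omega
  have hdeg : ∀ v, dg F v ≤ d v := by
    refine dg_headGraph_le_of_head H fun v hv hv' => ?_
    rcases (show v.val + 3 = r ∨ v = b2 ∨ v = b3 ∨ v = b4 by
      simp only [Fin.ext_iff, hb2, hb3, hb4]; omega) with k | rfl | rfl | rfl
    · exact (dg_headGraph_le_one hrn hv').trans (h1 v k)
    · have e1 := dg_headGraph_le_two (P := densePairs r) hrn hv' hb4.le n24
        (Or.inl (by unfold densePairs; omega))
      have e2 := h3 b3 (by omega)
      have e3 := H.anti (show v ≤ b3 from Fin.le_def.2 (by omega))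
      omega
    · have e1 := dg_headGraph_le_two (P := densePairs r) hrn hv' hb4.le n34
        (Or.inl (by unfold densePairs; omega))
      have e2 := h3 v (by omega)
      omega
    · have e1 := dg_headGraph_le_three (P := densePairs r) (v := v) (a := b2) (b := b3) hrn hv'
        (by omega) (by omega) (by omega) (by omega) (by omega)
        (Or.inr (by unfold densePairs; omega)) (Or.inr (by unfold densePairs; omega))
      have e2 := H.last v hb4
      omega
  obtain ⟨Q, hQ⟩ := Sub.steps (F := F) (lo := 0) (d := d) (Nat.zero_le (r + 1)) hrn
    ⟨F, Sub.refl hdeg⟩ (by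
      intro x _ hx Q h
      by_cases hx2 : x.val + 2 < r
      · refine not_stuck_of_complete H.real H.anti hFS (by omega) (fun a b ha hb hne => ?_) h
        have := Fin.le_def.1 ha
        exact hFadj' a b hne (by omega) hb
      by_cases hxr : x.val < r
      · have hcount : #(headSet n r) ≤ en Q x (headSet n r) + #({x, b4} : Finset (Fin n)) := by
          refine card_le_en_add fun u hu hux => ?_
          simp only [mem_insert, mem_singleton, not_or, Fin.ext_iff] at hux
          rw [mem_headSet] at hu
          exact h.le _ _ (hFadj x u (fun e => hux.1 (by rw [e])) hxr (by omega))
        have := card_le_two (a := x) (b := b4)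
        refine h.false_of_clique H.real H.anti (S := headSet n r) (fun v hv => mem_headSet.2 ?_)
          (fun a b k => mem_headSet.2 (hFS a b k)) ?_ (by omega) ?_
        · have := Fin.le_def.1 hv; omega
        · intro a ha b hb hne
          rw [Fin.le_def] at ha hb
          exact h.le _ _ (hFadj a b hne (by omega) (by omega))
        · intro l hl hxl
          rw [mem_headSet] at hl
          rw [Fin.lt_def] at hxl
          by_cases hlr : l.val < r
          · refine Or.inl fun v hv => ?_
            rw [Fin.le_def] at hv
            exact h.le _ _ (hFadj l v (by rintro rfl; omega) hlr (by omega))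
          · refine Or.inr fun w hw => ?_
            rw [hF, headGraph_adj] at hw
            have := hw.2.2.2.2
            have hne : l.val ≠ w.val := fun e => hw.1 (Fin.ext e)
            unfold densePairs at this
            rw [Fin.le_def]
            omega
      · obtain rfl : x = b4 := Fin.ext (by omega)
        have hFlow : ∀ a b : Fin n, a ≠ b → a < x → b < x → Q.Adj a b := fun a b k1 k2 k3 =>
          h.le _ _ (hFadj a b k1 (by rw [Fin.lt_def] at k2; omega)
            (by rw [Fin.lt_def] at k3; omega))
        by_cases hall : ∀ v, v < x → Q.Adj v x
        · have hclique : ∀ a ≤ x, ∀ b ≤ x, a ≠ b → Q.Adj a b := by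
            intro a ha b hb hne
            rcases ha.lt_or_eq with ha | rfl
            · rcases hb.lt_or_eq with hb | rfl
              · exact hFlow a b hne ha hb
              · exact hall a ha
            · exact (hall b (lt_of_le_of_ne hb hne.symm)).symm
          have hcount : #(headSet n r) ≤ en Q x (headSet n r) + #({x} : Finset (Fin n)) := by
            refine card_le_en_add fun u hu hux => ?_
            rw [mem_headSet] at hu
            rw [mem_singleton] at hux
            exact hclique x le_rfl u (Fin.le_def.2 (by omega)) (Ne.symm hux)
          rw [card_singleton] at hcount
          refine h.false_of_clique H.real H.anti (S := headSet n r) (fun v hv => mem_headSet.2 ?_)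
            (fun a b k => mem_headSet.2 (hFS a b k)) hclique (by omega) ?_
          · have := Fin.le_def.1 hv; omega
          · intro l hl hxl
            rw [mem_headSet] at hl
            rw [Fin.lt_def] at hxl
            omega
        · push Not at hall
          obtain ⟨v, hv, hvx⟩ := hall
          have hv' := Fin.lt_def.1 hv
          have hvN : ∀ u, Q.Adj v u → u ∈ headSet n r \ {v, x} := by
            intro u hu
            simp only [mem_sdiff, mem_headSet, mem_insert, mem_singleton, not_or]
            refine ⟨?_, hu.ne', by rintro rfl; exact hvx hu⟩
            by_contra hur
            refine h.false_of_shift hv (Fin.lt_def.2 (by omega)) hu (fun k => ?_) hvx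
            have := hFS _ _ k.symm
            omega
          have hdv : dg Q v ≤ r - 1 := by
            have e1 := card_le_card (s := {u | Q.Adj v u}) (t := headSet n r \ {v, x})
              (fun u hu => hvN u (mem_filter.1 hu).2)
            rw [card_sdiff_of_subset, card_headSet hrn, card_pair hv.ne] at e1
            · exact e1
            · simp [insert_subset_iff, mem_headSet, hb4]; omega
          have hdv' := h.sat v hv
          have hdx := H.anti hv.le
          have hW := card_val_Icc (n := n) (a := 0) (b := r - 3) (by omega)
          have hWadj : ∀ w ∈ ({v | 0 ≤ v.val ∧ v.val ≤ r - 3} : Finset (Fin n)), Q.Adj x w := by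
            intro w hw
            simp only [mem_filter, mem_univ, true_and] at hw
            exact (h.le _ _ (hFadj' w x (by rintro rfl; omega) (by omega) (by omega))).symm
          have hge := card_le_dg hWadj
          have hlt := h.lt
          obtain ⟨y, hy, hyd⟩ := h.exists_deficient H.real (by omega)
          have hyx := h.adj_of_deficient hy hyd
          have hge' := card_le_dg (Q := Q) (v := x)
            (W := insert y ({v | 0 ≤ v.val ∧ v.val ≤ r - 3} : Finset (Fin n)))
            (fun w hw => by
              rcases mem_insert.1 hw with rfl | hw
              · exact hyx
              · exact hWadj w hw)
          rw [card_insert_of_notMem] at hge'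
          · omega
          · rw [Fin.lt_def] at hy
            simp only [mem_filter, mem_univ, true_and]; omega)
  refine H.exists_of_core hQ hFS fun a b k => ?_
  rw [headGraph_adj] at k
  refine ⟨k.1, k.2.1, k.2.2.1, ?_⟩
  have := k.2.2.2
  unfold corePairs at this
  unfold densePairs
  omega

/-- The missing pairs when the last four head vertices all have degree `r - 1`. -/
def matchingPairs (r i j : ℕ) : Prop := i + 3 = r ∧ j = r ∨ i + 2 = r ∧ j + 1 = r

theorem Hyp.exists_of_matching (H : Hyp r d G) (h1 : ∀ v : Fin n, v.val + 3 = r → d v ≤ r - 1)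
    (h4 : ∀ v : Fin n, v.val = r → r - 1 ≤ d v) :
    ∃ Q, (∀ v, dg Q v = d v) ∧
      ContainsCopy Q (KsubH (r + 1) 4 (by have := H.four_le; omega) Z4) := by
  have hr := H.four_le
  have hrn := H.lt
  obtain ⟨b1, hb1⟩ : ∃ b : Fin n, b.val = r - 3 := ⟨⟨r - 3, by omega⟩, rfl⟩
  obtain ⟨b4, hb4⟩ : ∃ b : Fin n, b.val = r := ⟨⟨r, by omega⟩, rfl⟩
  set F := headGraph n r (matchingPairs r) with hF
  have hFS : ∀ a b, F.Adj a b → a.val ≤ r := fun a b k => k.2.1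
  have hpart : ∀ v : Fin n, r - 3 ≤ v.val → v.val ≤ r → ∃ a : Fin n, a.val ≤ r ∧ v ≠ a ∧
      (matchingPairs r v.val a.val ∨ matchingPairs r a.val v.val) ∧
      ∀ u : Fin n, u.val ≤ r → u ≠ v → u ≠ a → F.Adj v u := by
    intro v hv hv'
    refine ⟨⟨2 * r - 3 - v.val, by omega⟩, by simp only; omega, ?_, ?_, ?_⟩
    · rw [Ne, Fin.ext_iff]; simp only; omega
    · unfold matchingPairs; simp only; omega
    · intro u hu h1 h2
      refine ⟨h1.symm, hv', hu, ?_⟩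
      rw [Ne, Fin.ext_iff] at h1 h2
      unfold matchingPairs
      simp only at h2
      omega
  have hd4 : ∀ v : Fin n, v.val ≤ r → r - 1 ≤ d v := fun v hv =>
    (h4 b4 hb4).trans (H.anti (Fin.le_def.2 (by omega)))
  have hd1 : ∀ v : Fin n, r - 3 ≤ v.val → d v ≤ r - 1 := fun v hv =>
    (H.anti (Fin.le_def.2 (by omega))).trans (h1 b1 (by omega))
  have hdeg : ∀ v, dg F v ≤ d v := by
    refine dg_headGraph_le_of_head H fun v hv hv' => ?_
    obtain ⟨a, ha, hne, hP, -⟩ := hpart v hv hv'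
    exact (dg_headGraph_le_two hrn hv' ha hne hP).trans (hd4 v hv')
  obtain ⟨Q, hQ⟩ := Sub.steps (F := F) (lo := 0) (d := d) (Nat.zero_le (r + 1)) hrn
    ⟨F, Sub.refl hdeg⟩ (by
      intro x _ hx Q h
      by_cases hx2 : x.val < r - 3
      · refine not_stuck_of_complete H.real H.anti hFS (by omega) (fun a b ha hb hne => ?_) h
        rw [Fin.le_def] at ha
        refine ⟨hne, by omega, hb, ?_⟩
        unfold matchingPairs; omega
      · obtain ⟨a, ha, hne, -, hadj⟩ := hpart x (by omega) (by omega)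
        have hcount : #(headSet n r) ≤ en Q x (headSet n r) + #({x, a} : Finset (Fin n)) := by
          refine card_le_en_add fun u hu hux => ?_
          simp only [mem_insert, mem_singleton, not_or] at hux
          exact h.le _ _ (hadj u (mem_headSet.1 hu) hux.1 hux.2)
        have e1 := card_le_two (a := x) (b := a)
        have e2 := en_le_dg Q x (headSet n r)
        have e3 := card_headSet hrn
        have e4 := hd1 x (by omega)
        have e5 := h.lt
        omega)
  refine H.exists_of_core hQ hFS fun a b k => ?_
  rw [headGraph_adj] at k
  refine ⟨k.1, k.2.1, k.2.2.1, ?_⟩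
  have := k.2.2.2
  unfold corePairs at this
  unfold matchingPairs
  omega

theorem Hyp.exists_of_tight (H : Hyp r d G) (h1 : ∀ v : Fin n, v.val + 3 = r → d v ≤ r - 1)
    (h4 : ∀ v : Fin n, v.val = r → d v ≤ r - 2) :
    ∃ Q, (∀ v, dg Q v = d v) ∧
      ContainsCopy Q (KsubH (r + 1) 4 (by have := H.four_le; omega) Z4) := by
  have hr := H.four_le
  have hrn := H.lt
  obtain ⟨b1, hb1⟩ : ∃ b : Fin n, b.val = r - 3 := ⟨⟨r - 3, by omega⟩, rfl⟩
  obtain ⟨b2, hb2⟩ : ∃ b : Fin n, b.val = r - 2 := ⟨⟨r - 2, by omega⟩, rfl⟩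
  obtain ⟨b3, hb3⟩ : ∃ b : Fin n, b.val = r - 1 := ⟨⟨r - 1, by omega⟩, rfl⟩
  obtain ⟨b4, hb4⟩ : ∃ b : Fin n, b.val = r := ⟨⟨r, by omega⟩, rfl⟩
  set F := headGraph n r (corePairs r) with hF
  have hFS : ∀ a b, F.Adj a b → a.val ≤ r := fun a b k => k.2.1
  have hd4 : ∀ v : Fin n, v.val ≤ r → r - 2 ≤ d v := fun v hv =>
    (H.last b4 hb4).trans (H.anti (Fin.le_def.2 (by omega)))
  have hd1 : ∀ v : Fin n, r - 3 ≤ v.val → d v ≤ r - 1 := fun v hv =>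
    (H.anti (Fin.le_def.2 (by omega))).trans (h1 b1 (by omega))
  have hdeg : ∀ v, dg F v ≤ d v := by
    refine dg_headGraph_le_of_head H fun v hv hv' => ?_
    rcases (show v = b1 ∨ v = b2 ∨ v = b3 ∨ v = b4 by
      simp only [Fin.ext_iff, hb1, hb2, hb3, hb4]; omega) with rfl | rfl | rfl | rfl
    · exact (dg_headGraph_le_two (a := b4) hrn hv' hb4.le (by rintro rfl; omega)
        (Or.inl (by unfold corePairs; omega))).trans (H.first v hb1)
    · exact (dg_headGraph_le_three (v := v) (a := b3) (b := b4) hrn hv'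
        (by omega) (by omega) (by omega) (by omega) (by omega)
        (Or.inl (by unfold corePairs; omega)) (Or.inl (by unfold corePairs; omega))).trans
        (hd4 v hv')
    · exact (dg_headGraph_le_three (v := v) (a := b2) (b := b4) hrn hv'
        (by omega) (by omega) (by omega) (by omega) (by omega)
        (Or.inr (by unfold corePairs; omega)) (Or.inl (by unfold corePairs; omega))).trans
        (hd4 v hv')
    · exact (dg_headGraph_le_three (v := v) (a := b2) (b := b3) hrn hv'
        (by omega) (by omega) (by omega) (by omega) (by omega)
        (Or.inr (by unfold corePairs; omega)) (Or.inr (by unfold corePairs; omega))).trans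
        (hd4 v hv')
  have key : ∀ x : Fin n, ∀ Q, Stuck F 0 d x Q → ∀ W : Finset (Fin n), (∀ w ∈ W, F.Adj x w) →
      d x ≤ #W + 1 → ∃ y, x < y ∧ y ∈ W := by
    intro x Q h W hW hle
    by_contra! hc
    have hWadj : ∀ w ∈ W, Q.Adj x w := fun w hw => h.le _ _ (hW w hw)
    have hge := card_le_dg hWadj
    have hlt := h.lt
    obtain ⟨y, hy, hyd⟩ := h.exists_deficient H.real (by omega)
    have hyx := h.adj_of_deficient hy hyd
    have hge' := card_le_dg (Q := Q) (v := x) (W := insert y W) (fun w hw => by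
      rcases mem_insert.1 hw with rfl | hw
      · exact hyx
      · exact hWadj w hw)
    rw [card_insert_of_notMem (hc y hy)] at hge'
    omega
  obtain ⟨Q, hQ⟩ := Sub.steps (F := F) (lo := 0) (d := d) (Nat.zero_le (r + 1)) hrn
    ⟨F, Sub.refl hdeg⟩ (by
      intro x _ hx Q h
      by_cases hx2 : x.val < r - 3
      · refine not_stuck_of_complete H.real H.anti hFS (by omega) (fun a b ha hb hne => ?_) h
        rw [Fin.le_def] at ha
        exact ⟨hne, by omega, hb, not_corePairs (by omega)⟩
      by_cases hx1 : x = b1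
      · have hcount : #(headSet n r) ≤ en Q x (headSet n r) + #({x, b4} : Finset (Fin n)) := by
          refine card_le_en_add fun u hu hux => h.le _ _ ?_
          simp only [mem_insert, mem_singleton, not_or] at hux
          rw [mem_headSet] at hu
          refine ⟨Ne.symm hux.1, by omega, hu, ?_⟩
          rw [Fin.ext_iff, Fin.ext_iff] at hux
          have := congrArg Fin.val hx1
          unfold corePairs
          omega
        have e1 := card_le_two (a := x) (b := b4)
        have e2 := en_le_dg Q x (headSet n r)
        have e3 := card_headSet hrn
        have e4 := hd1 x (by omega)
        have e5 := h.lt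
        omega
      by_cases hx4 : x = b4
      · have hW := card_val_Icc (n := n) (a := 0) (b := r - 4) (by omega)
        have hx4' := congrArg Fin.val hx4
        obtain ⟨y, hy, hyW⟩ := key x Q h {v | 0 ≤ v.val ∧ v.val ≤ r - 4} (fun w hw => by
          simp only [mem_filter, mem_univ, true_and] at hw
          exact SimpleGraph.Adj.symm ⟨by rintro rfl; omega, by omega, by omega,
            not_corePairs (by omega)⟩) (by have := h4 x (by omega); omega)
        simp only [mem_filter, mem_univ, true_and] at hyW
        rw [Fin.lt_def] at hy
        omega
      · have hW := card_val_Icc (n := n) (a := 0) (b := r - 3) (by omega)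
        rw [Fin.ext_iff] at hx1 hx4
        obtain ⟨y, hy, hyW⟩ := key x Q h {v | 0 ≤ v.val ∧ v.val ≤ r - 3} (fun w hw => by
          simp only [mem_filter, mem_univ, true_and] at hw
          refine ⟨by rintro rfl; omega, by omega, by omega, ?_⟩
          unfold corePairs; omega) (by have := hd1 x (by omega); omega)
        simp only [mem_filter, mem_univ, true_and] at hyW
        rw [Fin.lt_def] at hy
        omega)
  exact H.exists_of_core hQ hFS fun a b k => k

theorem exists_unique_miss {v : Fin n} {W : Finset (Fin n)} (h : en Q v W + 1 = #W) :
    ∃ w ∈ W, ∀ u ∈ W, u ≠ w → Q.Adj v u := by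
  have hcard : #({u ∈ W | ¬ Q.Adj v u}) = 1 := by
    have := card_filter_add_card_filter_not (s := W) (fun u => Q.Adj v u)
    unfold en at h
    omega
  obtain ⟨w, hw⟩ := card_eq_one.1 hcard
  have hmem : w ∈ ({u ∈ W | ¬ Q.Adj v u} : Finset (Fin n)) := by rw [hw]; simp
  refine ⟨w, (mem_filter.1 hmem).1, fun u hu hne => ?_⟩
  by_contra hn
  have : u ∈ ({u ∈ W | ¬ Q.Adj v u} : Finset (Fin n)) := mem_filter.2 ⟨hu, hn⟩
  rw [hw, mem_singleton] at this
  exact hne this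

/-- The missing pairs when the last three head vertices are kept independent. -/
def sparsePairs (r i j : ℕ) : Prop := i + 2 = r ∧ j + 1 = r ∨ (i + 2 = r ∨ i + 1 = r) ∧ j = r

/-- A head realization whose first `r - 1` vertices form a clique, each of the next two missing
just one of them. -/
theorem Hyp.exists_sparse_head (H : Hyp r d G) (h1 : ∀ v : Fin n, v.val + 3 = r → r ≤ d v)
    (h3 : ∀ v : Fin n, v.val + 1 = r → d v ≤ r - 2) :
    ∃ Q, Sub (headGraph n (r - 2) fun _ _ => False) 0 d (r + 1) Q ∧
      ∀ b : Fin n, r - 1 ≤ b.val → b.val ≤ r →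
        en Q b (headSet n (r - 2)) + 1 = #(headSet n (r - 2)) := by
  have hr := H.four_le
  have hrn := H.lt
  obtain ⟨b2, hb2⟩ : ∃ b : Fin n, b.val = r - 2 := ⟨⟨r - 2, by omega⟩, rfl⟩
  obtain ⟨b3, hb3⟩ : ∃ b : Fin n, b.val = r - 1 := ⟨⟨r - 1, by omega⟩, rfl⟩
  obtain ⟨b4, hb4⟩ : ∃ b : Fin n, b.val = r := ⟨⟨r, by omega⟩, rfl⟩
  set F := headGraph n r (sparsePairs r) with hF
  have hFS : ∀ a b, F.Adj a b → a.val ≤ r := fun a b k => k.2.1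
  have hFadj : ∀ a b : Fin n, a ≠ b → a.val + 2 < r → b.val ≤ r → F.Adj a b :=
    fun a b k1 k2 k3 => by
      refine ⟨k1, by omega, k3, ?_⟩
      unfold sparsePairs; omega
  have hd4 : ∀ v : Fin n, v.val ≤ r → r - 2 ≤ d v := fun v hv =>
    (H.last b4 hb4).trans (H.anti (Fin.le_def.2 (by omega)))
  have hd3 : ∀ v : Fin n, r - 1 ≤ v.val → d v ≤ r - 2 := fun v hv =>
    (H.anti (Fin.le_def.2 (by omega))).trans (h3 b3 (by omega))
  have hdeg : ∀ v, dg F v ≤ d v := by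
    refine dg_headGraph_le_of_head H fun v hv hv' => ?_
    rcases (show v.val + 3 = r ∨ v = b2 ∨ v = b3 ∨ v = b4 by
      simp only [Fin.ext_iff, hb2, hb3, hb4]; omega) with k | rfl | rfl | rfl
    · exact (dg_headGraph_le_one hrn hv').trans (h1 v k)
    · exact (dg_headGraph_le_three (v := v) (a := b3) (b := b4) hrn hv'
        (by omega) (by omega) (by omega) (by omega) (by omega)
        (Or.inl (by unfold sparsePairs; omega)) (Or.inl (by unfold sparsePairs; omega))).trans
        (hd4 v hv')
    · exact (dg_headGraph_le_three (v := v) (a := b2) (b := b4) hrn hv'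
        (by omega) (by omega) (by omega) (by omega) (by omega)
        (Or.inr (by unfold sparsePairs; omega)) (Or.inl (by unfold sparsePairs; omega))).trans
        (hd4 v hv')
    · exact (dg_headGraph_le_three (v := v) (a := b2) (b := b3) hrn hv'
        (by omega) (by omega) (by omega) (by omega) (by omega)
        (Or.inr (by unfold sparsePairs; omega)) (Or.inr (by unfold sparsePairs; omega))).trans
        (hd4 v hv')
  obtain ⟨Q, hQ⟩ := Sub.steps (F := F) (lo := 0) (d := d) (Nat.zero_le (r - 2)) (by omega)
    ⟨F, Sub.refl hdeg⟩ (fun x _ hx Q h => not_stuck_of_complete H.real H.anti hFS (by omega)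
      (fun a b ha hb hne => hFadj a b hne (by rw [Fin.le_def] at ha; omega) hb) h)
  set W := headGraph n (r - 2) fun _ _ => False with hW
  have hWadj : ∀ a b : Fin n, W.Adj a b ↔ a ≠ b ∧ a.val ≤ r - 2 ∧ b.val ≤ r - 2 := fun a b => by
    simp [hW, headGraph_adj]
  set lo : Fin n → ℕ := fun v => if r - 1 ≤ v.val ∧ v.val ≤ r then r - 2 else 0 with hlo
  have hQ2 : Sub W lo d b2.val Q := by
    refine hQ.mono (fun a b k => hQ.le _ _ ?_) (fun a b ha hb k => ?_) (fun v => ?_) hb2.le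
    · rw [hWadj] at k
      rcases (show a.val + 2 < r ∨ b.val + 2 < r by
        have : a.val ≠ b.val := fun e => k.1 (Fin.ext e)
        omega) with k' | k'
      · exact hFadj a b k.1 k' (by omega)
      · exact (hFadj b a k.1.symm k' (by omega)).symm
    · exfalso
      have k1 := hQ.indep a b (by omega) (by omega) k
      rw [hF, headGraph_adj] at k1
      have : a.val ≠ b.val := fun e => k1.1 (Fin.ext e)
      unfold sparsePairs at k1
      omega
    · simp only [hlo]
      split_ifs with hv
      · have e1 := card_val_Icc (n := n) (a := 0) (b := r - 3) (by omega)
        have e2 := card_le_dg (Q := Q) (v := v) (W := {v | 0 ≤ v.val ∧ v.val ≤ r - 3})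
          (fun w hw => by
            simp only [mem_filter, mem_univ, true_and] at hw
            exact (hQ.le _ _ (hFadj w v (by rintro rfl; omega) (by omega) (by omega))).symm)
        omega
      · exact Nat.zero_le _
  obtain ⟨Q', hQ', hsat⟩ := hQ2.saturate b2 (fun Q h =>
    not_stuck_of_complete (r := r - 2) H.real H.anti
      (fun a b k => ((hWadj a b).1 k).2.1) hb2.le
      (fun a b ha hb hne => (hWadj a b).2 ⟨hne, by rw [Fin.le_def] at ha; omega, hb⟩) h)
  have htop : ∀ b : Fin n, r - 1 ≤ b.val → b.val ≤ r → dg Q' b = r - 2 ∧ d b = r - 2 := by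
    intro b hb hb'
    have e1 := hQ'.lo_le b
    simp only [hlo, hb, hb', and_self, if_true] at e1
    have e2 := hd3 b hb
    have e3 := hQ'.le_d b
    omega
  refine ⟨Q', ⟨hQ'.le, hQ'.le_d, fun v hv => ?_,
    fun a b ha hb => hQ'.indep a b (by omega) (by omega),
    by simp⟩, fun b hb hb' => ?_⟩
  · by_cases hv2 : v.val < b2.val
    · exact hQ'.sat v hv2
    · by_cases hv3 : v = b2
      · rwa [hv3]
      · have := htop v (by rw [Fin.ext_iff] at hv3; omega) (by omega)
        omega
  · rw [card_headSet (by omega), en_eq_dg, (htop b hb hb').1]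
    intro u hu
    rw [mem_headSet]
    by_contra hur
    have := (hWadj _ _).1 (hQ'.indep b u (by omega) (by omega) hu)
    omega

theorem Hyp.exists_of_sparse (H : Hyp r d G) (h1 : ∀ v : Fin n, v.val + 3 = r → r ≤ d v)
    (h3 : ∀ v : Fin n, v.val + 1 = r → d v ≤ r - 2) :
    ∃ Q, (∀ v, dg Q v = d v) ∧
      ContainsCopy Q (KsubH (r + 1) 4 (by have := H.four_le; omega) Z4) := by
  have hr := H.four_le
  have hrn := H.lt
  obtain ⟨Q, hQ, hmiss⟩ := H.exists_sparse_head h1 h3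
  obtain ⟨b3, hb3⟩ : ∃ b : Fin n, b.val = r - 1 := ⟨⟨r - 1, by omega⟩, rfl⟩
  obtain ⟨b4, hb4⟩ : ∃ b : Fin n, b.val = r := ⟨⟨r, by omega⟩, rfl⟩
  set F : SimpleGraph (Fin n) := Q ⊓ headGraph n r fun _ _ => False with hF
  have hFadj : ∀ a b : Fin n, F.Adj a b ↔ Q.Adj a b ∧ a.val ≤ r ∧ b.val ≤ r := fun a b => by
    simp only [hF, SimpleGraph.inf_adj, headGraph_adj, not_false_eq_true, and_true]
    exact ⟨fun k => ⟨k.1, k.2.2⟩, fun k => ⟨k.1, k.1.ne, k.2⟩⟩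
  have hsub : Sub F 0 d (r + 1) Q := by
    refine hQ.mono (fun a b k => ((hFadj a b).1 k).1) (fun a b ha hb k => ?_) (by simp) le_rfl
    have := (hQ.indep a b ha hb k).2.1
    omega
  obtain ⟨Q', hQ', hle⟩ := exists_realization_of_head hr hrn H.real H.anti hsub
    (fun a b k => ((hFadj a b).1 k).2.1) H.early (by
      intro v hv hv'
      have e1 := h3 b3 (by omega)
      have e2 := H.anti (show b3 ≤ v from Fin.le_def.2 (by omega))
      omega)
  refine ⟨Q', hQ', ?_⟩
  set W := headSet n (r - 2) with hW
  have hWcard : #W = r - 1 := by rw [hW, card_headSet (by omega)]; omega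
  have hclique : ∀ a ∈ W, ∀ b ∈ W, a ≠ b → Q'.Adj a b := by
    intro a ha b hb hne
    rw [hW, mem_headSet] at ha hb
    exact hle _ _ ((hFadj a b).2 ⟨hQ.le _ _ ⟨hne, ha, hb, by simp⟩, by omega, by omega⟩)
  have htop : ∀ b : Fin n, r - 1 ≤ b.val → b.val ≤ r →
      b ∉ W ∧ ∃ w ∈ W, ∀ u ∈ W, u ≠ w → Q'.Adj b u := by
    intro b hb hb'
    refine ⟨fun k => ?_, ?_⟩
    · rw [hW, mem_headSet] at k; omega
    obtain ⟨w, hw, hadj⟩ := exists_unique_miss (hmiss b hb hb')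
    refine ⟨w, hw, fun u hu hne => hle _ _ ((hFadj b u).2 ⟨hadj u hu hne, hb', ?_⟩)⟩
    rw [hW, mem_headSet] at hu; omega
  obtain ⟨hb3W, w3, hw3, hadj3⟩ := htop b3 (by omega) (by omega)
  obtain ⟨hb4W, w4, hw4, hadj4⟩ := htop b4 (by omega) (by omega)
  have h34 : b3 ≠ b4 := by rintro rfl; omega
  have hne : ∀ b, b ∉ W → ∀ w ∈ W, b ≠ w := by rintro b hb w hw rfl; exact hb hw
  have hcard : ∀ a ∈ W, ∀ b ∈ W, a ≠ b → #(W \ {a, b}) = r - 3 := by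
    intro a ha b hb hab
    rw [card_sdiff_of_subset (by simp [insert_subset_iff, ha, hb]), hWcard, card_pair hab]
    omega
  have hmem : ∀ a b u, u ∈ W \ {a, b} ↔ u ∈ W ∧ u ≠ a ∧ u ≠ b := by
    intro a b u; simp
  by_cases hw : w3 = w4
  · subst hw
    obtain ⟨c, hc, hcw⟩ := exists_mem_ne (s := W) (by omega) w3
    refine containsCopy_of_parts hr Q' (W \ {w3, c}) (hcard _ hw3 _ hc hcw.symm) b3 c b4 w3
      ⟨by simp [hb3W], by simp, by simp [hb4W], by simp⟩
      ⟨hne _ hb3W _ hc, h34, hne _ hb3W _ hw3, (hne _ hb4W _ hc).symm, hcw, hne _ hb4W _ hw3⟩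
      ?_ ?_ (hadj3 c hc hcw) (hadj4 c hc hcw).symm
    · intro a ha b hb
      exact hclique a ((hmem _ _ _).1 ha).1 b ((hmem _ _ _).1 hb).1
    · intro a ha
      obtain ⟨k1, k2, k3⟩ := (hmem _ _ _).1 ha
      exact ⟨hadj3 a k1 k2, hclique c hc a k1 k3.symm, hadj4 a k1 k2, hclique w3 hw3 a k1 k2.symm⟩
  · refine containsCopy_of_parts hr Q' (W \ {w3, w4}) (hcard _ hw3 _ hw4 hw) b3 w4 w3 b4
      ⟨by simp [hb3W], by simp, by simp, by simp [hb4W]⟩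
      ⟨hne _ hb3W _ hw4, hne _ hb3W _ hw3, h34, Ne.symm hw, (hne _ hb4W _ hw4).symm,
        (hne _ hb4W _ hw3).symm⟩ ?_ ?_ (hadj3 w4 hw4 (Ne.symm hw))
        (hclique w4 hw4 w3 hw3 (Ne.symm hw))
    · intro a ha b hb
      exact hclique a ((hmem _ _ _).1 ha).1 b ((hmem _ _ _).1 hb).1
    · intro a ha
      obtain ⟨k1, k2, k3⟩ := (hmem _ _ _).1 ha
      exact ⟨hadj3 a k1 k2, hclique w4 hw4 a k1 k3.symm, hclique w3 hw3 a k1 k2.symm, hadj4 a k1 k3⟩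

theorem Hyp.exists_realization (H : Hyp r d G) :
    ∃ Q, (∀ v, dg Q v = d v) ∧
      ContainsCopy Q (KsubH (r + 1) 4 (by have := H.four_le; omega) Z4) := by
  have hr := H.four_le
  have hrn := H.lt
  have hval : ∀ (i : ℕ) (hi : i < n) (v : Fin n), v.val = i → d v = d ⟨i, hi⟩ :=
    fun i hi v hv => congrArg d (Fin.ext hv)
  have e1 := hval (r - 3) (by omega)
  have e3 := hval (r - 1) (by omega)
  have e4 := hval r (by omega)
  by_cases c1 : r ≤ d ⟨r - 3, by omega⟩
  · by_cases c3 : r - 1 ≤ d ⟨r - 1, by omega⟩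
    · exact H.exists_of_dense (fun v hv => by rw [e1 v (by omega)]; exact c1)
        (fun v hv => by rw [e3 v (by omega)]; exact c3)
    · exact H.exists_of_sparse (fun v hv => by rw [e1 v (by omega)]; exact c1)
        (fun v hv => by rw [e3 v (by omega)]; omega)
  · by_cases c4 : r - 1 ≤ d ⟨r, by omega⟩
    · exact H.exists_of_matching (fun v hv => by rw [e1 v (by omega)]; omega)
        (fun v hv => by rw [e4 v hv]; exact c4)
    · exact H.exists_of_tight (fun v hv => by rw [e1 v (by omega)]; omega)
        (fun v hv => by rw [e4 v hv]; omega)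

end SubRealization

/-- Lemma 3.3: let `r ≥ 4`, `n ≥ 2r + 2` and `π = (d₁, ..., dₙ)` be an `n`-term graphic
sequence with `d_{r-2} ≥ r - 1`, `d_{r+1} ≥ r - 2`, and
`σ(π) ≥ (r-1)(2n-r) - 3(n-r) - 1` if `n - r` is odd, and
`σ(π) ≥ (r-1)(2n-r) - 3(n-r) - 2` if `n - r` is even. If `d_i ≥ 2r - i` for
`i = 1, 2, ..., r - 3`, then `π` is potentially `K_{r+1} - Z₄`-graphic. -/
theorem stmt6 (r n : ℕ) (hr : 4 ≤ r) (hn : 2 * r + 2 ≤ n)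
    (d : Fin n → ℕ) (hgraphic : IsGraphic d)
    (h1 : r - 1 ≤ nth d (r - 2)) (h2 : r - 2 ≤ nth d (r + 1))
    (hσ : (if Odd (n - r)
        then ((r : ℤ) - 1) * (2 * (n : ℤ) - r) - 3 * ((n : ℤ) - r) - 1
        else ((r : ℤ) - 1) * (2 * (n : ℤ) - r) - 3 * ((n : ℤ) - r) - 2)
      ≤ ∑ i, (d i : ℤ))
    (h3 : ∀ i : ℕ, 1 ≤ i → i ≤ r - 3 → 2 * r - i ≤ nth d i) :
    PotentiallyGraphic d (KsubH (r + 1) 4 (by omega) Z4) := by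
  obtain ⟨hanti, G, hG⟩ := hgraphic
  have hnth : ∀ v : Fin n, nth d (v.val + 1) = d v := fun v => by
    unfold nth
    rw [dif_pos (by simp)]
    rfl
  have H : SubRealization.Hyp r d G :=
    { four_le := hr
      lt := by omega
      real := fun v => by rw [SubRealization.dg_eq_degree]; exact hG v
      anti := hanti
      early := fun v hv => by
        have := h3 (v.val + 1) (by omega) (by omega)
        rw [hnth] at this
        omega
      first := fun v hv => by
        rwa [show r - 2 = v.val + 1 by omega, hnth] at h1
      last := fun v hv => by
        rwa [show r + 1 = v.val + 1 by omega, hnth] at h2 }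
  obtain ⟨Q, hQ, hcopy⟩ := H.exists_realization
  exact ⟨Q, fun v => by rw [← SubRealization.dg_eq_degree]; exact hQ v, hcopy⟩
end
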